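/- arXiv:2003.04280 — 4 statements merged into one kernel-verified Lean document; each statement's English description precedes it below -/
import Mathlib

section
/- Let T be a non-empty binary search tree and let I be a non-empty finite subset of ℝ ∖ V(T) such that V(T) 1-chunks I. Let T' be the tree obtained from T by applying BulkInsert(I). Then for every node x of T, |T_x| ≤ |T'_x| < 4·|T_x|, where T_x and T'_x denote the subtrees of T and of T' rooted at x, and |·| denotes the number of nodes. -/
attribute [local instance] Classical.propDecidable

/-- A binary tree with real-number node values. -/
inductive BT : Type
  | leaf : BT
  | node : BT → ℝ → BT → BT

namespace BT

/-- The set of values stored in the tree. -/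
noncomputable def nodes : BT → Finset ℝ
  | .leaf => ∅
  | .node l v r => insert v (nodes l ∪ nodes r)

/-- The signature of `x` in the tree: the bit string of the search path for `x`
(`false` = step to a left child, `true` = step to a right child). For a node `x` of the
tree, its length is the depth `d_T(x)`. -/
noncomputable def sig : BT → ℝ → List Bool
  | .leaf, _ => []
  | .node l v r, x =>
    if x < v then false :: sig l x
    else if v < x then true :: sig r x
    else []

/-- The number of nodes of the tree. -/
def size : BT → ℕ
  | .leaf => 0
  | .node l _ r => size l + size r + 1

/-- The binary-search-tree property: all values in a left subtree are smaller than the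
value at the node, all values in a right subtree are larger. -/
def isBST : BT → Prop
  | .leaf => True
  | .node l v r => (∀ x ∈ nodes l, x < v) ∧ (∀ x ∈ nodes r, v < x) ∧ isBST l ∧ isBST r

/-- The height of the tree: the maximum depth of a node (0 for the empty tree). -/
noncomputable def height (t : BT) : ℕ := (nodes t).sup fun x => (sig t x).length

/-- The subtree rooted at the node holding the value `x` (a leaf if `x` is absent). -/
noncomputable def subtreeAt : BT → ℝ → BT
  | .leaf, _ => .leaf
  | .node l v r, x =>
    if x < v then subtreeAt l x
    else if v < x then subtreeAt r x
    else .node l v r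

end BT

/-- `Chunks a X Y` : the finite set `X` `a`-chunks the finite set `Y`, i.e. every
`(a+1)`-element subset `S ⊆ Y` admits an `x ∈ X` with `min S ≤ x ≤ max S`
(equivalently, `s₁ ≤ x ≤ s₂` for some `s₁, s₂ ∈ S`). -/
def Chunks (a : ℕ) (X Y : Finset ℝ) : Prop :=
  ∀ S ⊆ Y, S.card = a + 1 → ∃ x ∈ X, (∃ s ∈ S, s ≤ x) ∧ ∃ s ∈ S, x ≤ s

namespace BT

/-- Standard binary search tree insertion: the new value is attached at the external
node ending its search path. -/
noncomputable def ins : BT → ℝ → BT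
  | .leaf, x => .node .leaf x .leaf
  | .node l v r, x =>
    if x < v then .node (ins l x) v r
    else if v < x then .node l v (ins r x)
    else .node l v r

end BT

/-- `t'` is obtained from `t` by `BulkInsert(I)`: inserting the elements of the finite
set `I` one by one, in some order, by standard binary search tree insertion. -/
def BulkInsertRel (t : BT) (I : Finset ℝ) (t' : BT) : Prop :=
  ∃ l : List ℝ, l.Nodup ∧ l.toFinset = I ∧ t' = l.foldl BT.ins t

namespace BT

theorem foldl_ins_node (L : List ℝ) : ∀ (a : BT) (v : ℝ) (b : BT),
    L.foldl ins (node a v b) =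
      node ((L.filter (fun x => decide (x < v))).foldl ins a) v
        ((L.filter (fun x => decide (v < x))).foldl ins b) := by
  induction L with
  | nil => intro a v b; simp
  | cons y L ih =>
    intro a v b
    rw [List.foldl_cons]
    rcases lt_trichotomy y v with h | h | h
    · have h2 : ¬ v < y := not_lt.mpr h.le
      simp [ins, ih, h, h2]
    · subst h
      simp [ins, ih]
    · have h2 : ¬ y < v := not_lt.mpr h.le
      simp [ins, ih, h, h2]

/-- Any two distinct elements of the duplicate-free list are separated by a node. -/
def Sep (t : BT) (L : List ℝ) : Prop :=
  L.Nodup ∧ ∀ s ∈ L, ∀ s' ∈ L, s < s' → ∃ x ∈ t.nodes, s ≤ x ∧ x ≤ s'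

theorem Sep.left {a b : BT} {v : ℝ} {L : List ℝ} (ht : (node a v b).isBST)
    (h : Sep (node a v b) L) : Sep a (L.filter (fun x => decide (x < v))) := by
  refine ⟨h.1.filter _, ?_⟩
  intro s hs s' hs' hlt
  simp only [List.mem_filter, decide_eq_true_eq] at hs hs'
  obtain ⟨x, hx, h1, h2⟩ := h.2 s hs.1 s' hs'.1 hlt
  refine ⟨x, ?_, h1, h2⟩
  simp only [nodes, Finset.mem_insert, Finset.mem_union] at hx
  rcases hx with hx | hx | hx
  · linarith [hs'.2]
  · exact hx
  · have := ht.2.1 x hx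
    linarith [hs'.2]

theorem Sep.right {a b : BT} {v : ℝ} {L : List ℝ} (ht : (node a v b).isBST)
    (h : Sep (node a v b) L) : Sep b (L.filter (fun x => decide (v < x))) := by
  refine ⟨h.1.filter _, ?_⟩
  intro s hs s' hs' hlt
  simp only [List.mem_filter, decide_eq_true_eq] at hs hs'
  obtain ⟨x, hx, h1, h2⟩ := h.2 s hs.1 s' hs'.1 hlt
  refine ⟨x, ?_, h1, h2⟩
  simp only [nodes, Finset.mem_insert, Finset.mem_union] at hx
  rcases hx with hx | hx | hx
  · linarith [hs.2]
  · have := ht.1 x hx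
    linarith [hs.2]
  · exact hx

theorem size_foldl (t : BT) : ∀ L : List ℝ, t.isBST → Sep t L →
    t.size ≤ (L.foldl ins t).size ∧ (L.foldl ins t).size ≤ 2 * t.size + 1 := by
  induction t with
  | leaf =>
    intro L _ h
    match L, h with
    | [], _ => simp [size]
    | [x], _ => simp [size, ins]
    | x :: y :: L, h =>
      exfalso
      have hne : x ≠ y := by
        have := h.1
        simp at this
        tauto
      rcases lt_or_gt_of_ne hne with hl | hl
      · obtain ⟨z, hz, _⟩ := h.2 x (by simp) y (by simp) hl
        simp [nodes] at hz
      · obtain ⟨z, hz, _⟩ := h.2 y (by simp) x (by simp) hl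
        simp [nodes] at hz
  | node a v b iha ihb =>
    intro L ht h
    have h1 := iha _ ht.2.2.1 (h.left ht)
    have h2 := ihb _ ht.2.2.2 (h.right ht)
    rw [foldl_ins_node]
    simp only [size]
    omega

theorem subtree_foldl (t : BT) : ∀ L : List ℝ, t.isBST → Sep t L → ∀ x ∈ t.nodes,
    (t.subtreeAt x).size ≤ ((L.foldl ins t).subtreeAt x).size ∧
    ((L.foldl ins t).subtreeAt x).size < 4 * (t.subtreeAt x).size := by
  induction t with
  | leaf => intro L _ _ x hx; simp [nodes] at hx
  | node a v b iha ihb =>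
    intro L ht h x hx
    have hsz := size_foldl _ L ht h
    rw [foldl_ins_node] at hsz ⊢
    simp only [nodes, Finset.mem_insert, Finset.mem_union] at hx
    rcases hx with hx | hx | hx
    · subst hx
      simp only [subtreeAt, lt_irrefl, if_false]
      simp only [size] at hsz ⊢
      omega
    · have hlt := ht.1 x hx
      simp only [subtreeAt, hlt, if_true]
      exact iha _ ht.2.2.1 (h.left ht) x hx
    · have hlt := ht.2.1 x hx
      have hn : ¬ x < v := not_lt.mpr hlt.le
      simp only [subtreeAt, hlt, hn, if_true, if_false]
      exact ihb _ ht.2.2.2 (h.right ht) x hx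

end BT

/-- bulk insertion and subtree sizes: if `V(T)` 1-chunks `I` and `T'`
is obtained from `T` by `BulkInsert(I)`, then for every node `x` of `T`,
`|T_x| ≤ |T'_x| < 4·|T_x|`, where `T_x` and `T'_x` are the subtrees rooted at `x`. -/
theorem bulkInsert_subtree_sizes (t : BT) (ht : t.isBST)
    (htne : t.nodes.Nonempty) (I : Finset ℝ) (hIne : I.Nonempty)
    (hdisj : ∀ x ∈ I, x ∉ t.nodes) (hchunk : Chunks 1 t.nodes I)
    (t' : BT) (h' : BulkInsertRel t I t') :
    ∀ x ∈ t.nodes,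
      (t.subtreeAt x).size ≤ (t'.subtreeAt x).size ∧
      (t'.subtreeAt x).size < 4 * (t.subtreeAt x).size := by
  obtain ⟨L, hnd, hL, rfl⟩ := h'
  refine BT.subtree_foldl t L ht ⟨hnd, ?_⟩
  intro s hs s' hs' hlt
  obtain ⟨x, hx, ⟨u, hu, hux⟩, ⟨w, hw, hxw⟩⟩ := hchunk {s, s'} (by
    intro z hz
    simp only [Finset.mem_insert, Finset.mem_singleton] at hz
    rw [← hL, List.mem_toFinset]
    rcases hz with rfl | rfl <;> assumption) (Finset.card_pair hlt.ne)
  simp only [Finset.mem_insert, Finset.mem_singleton] at hu hw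
  refine ⟨x, hx, ?_, ?_⟩
  · rcases hu with rfl | rfl <;> linarith
  · rcases hw with rfl | rfl <;> linarith
end

section
/- Let k ≥ 5 be an integer and let T_0,…,T_q be a one-phase k-bulk tree sequence. Then for each y ∈ {0,…,q}: (1) h(T_y) ≤ h(T_0) + 2y; and (2) every subtree of T_y rooted at a node of depth y·(k+1) has size at most |T_0| · 2^{−y(k−2)}. -/
attribute [local instance] Classical.propDecidable

namespace BT

/-- Delete the largest value of the tree (following the recursive deletion rule) and
return it together with the remaining tree. -/
noncomputable def extractMax : BT → Option (ℝ × BT)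
  | .leaf => none
  | .node l v .leaf =>
    match extractMax l with
    | none => some (v, .leaf)
    | some (m, l') => some (v, .node l' m .leaf)
  | .node l v (.node rl rv rr) =>
    match extractMax (.node rl rv rr) with
    | none => some (v, l)
    | some (m, r') => some (m, .node l v r')

/-- Delete the smallest value of the tree (following the recursive deletion rule) and
return it together with the remaining tree. -/
noncomputable def extractMin : BT → Option (ℝ × BT)
  | .leaf => none
  | .node .leaf v r =>
    match extractMin r with
    | none => some (v, .leaf)
    | some (m, r') => some (v, .node .leaf m r')
  | .node (.node ll lv lr) v r =>
    match extractMin (.node ll lv lr) with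
    | none => some (v, r)
    | some (m, l') => some (m, .node l' v r)

/-- Recursive deletion of the value `x`: if the node holding `x` is a leaf, remove it;
otherwise, if it has a left child, recursively delete the largest value of its left
subtree and replace `x` with it; otherwise recursively delete the smallest value of its
right subtree and replace `x` with it. -/
noncomputable def delete : BT → ℝ → BT
  | .leaf, _ => .leaf
  | .node l v r, x =>
    if x < v then .node (delete l x) v r
    else if v < x then .node l v (delete r x)
    else
      match extractMax l with
      | some (m, l') => .node l' m r
      | none =>
        match extractMin r with
        | some (m, r') => .node .leaf m r'
        | none => .leaf

end BT

/-- `t'` is obtained from `t` by `BulkDelete(D)`: deleting the elements of the finite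
set `D` one by one, in some order. -/
def BulkDeleteRel (t : BT) (D : Finset ℝ) (t' : BT) : Prop :=
  ∃ l : List ℝ, l.Nodup ∧ l.toFinset = D ∧ t' = l.foldl BT.delete t

namespace BT

/-- `Split(x)`: split a binary search tree along the search path of `x` into the two
binary search trees on `{z ∈ V(T) : z < x}` and `{z ∈ V(T) : z > x}`. -/
noncomputable def split : BT → ℝ → BT × BT
  | .leaf, _ => (.leaf, .leaf)
  | .node l v r, x =>
    if x < v then
      ((split l x).1, .node (split l x).2 v r)
    else if v < x then
      (.node l v (split r x).1, (split r x).2)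
    else (l, r)

end BT

namespace BT

/-- In-order (sorted, for a binary search tree) list of the values in the tree. -/
def inorder : BT → List ℝ
  | .leaf => []
  | .node l v r => inorder l ++ v :: inorder r

/-- `MultiSplit`: split a tree at an increasing list of values by splitting at the
median value and recursing on both sides; returns the ordered list of resulting trees. -/
noncomputable def multiSplit : BT → List ℝ → List BT
  | t, [] => [t]
  | t, x₀ :: xs' =>
    multiSplit (split t ((x₀ :: xs').getD (((x₀ :: xs').length + 1) / 2 - 1) 0)).1
        ((x₀ :: xs').take (((x₀ :: xs').length + 1) / 2 - 1)) ++
    multiSplit (split t ((x₀ :: xs').getD (((x₀ :: xs').length + 1) / 2 - 1) 0)).2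
        ((x₀ :: xs').drop (((x₀ :: xs').length + 1) / 2))
termination_by _ xs => xs.length
decreasing_by
  · simp [List.length_take]; omega
  · simp [List.length_drop]; omega

/-- Replace the external (leaf) positions of a tree, from left to right, by the trees of
the given list (this is the order consistent with the binary search tree property);
also returns the unused trees of the list. -/
def glue : BT → List BT → BT × List BT
  | .leaf, ts => (ts.headD .leaf, ts.tail)
  | .node l v r, ts =>
    ((.node (glue l ts).1 v (glue r (glue l ts).2).1), (glue r (glue l ts).2).2)

/-- The ordered list of subtrees hanging below depth `k`: one (possibly empty) tree for
each gap between consecutive nodes of depth `< k`; these are the trees of the forest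
`T − Z` where `Z` is the set of nodes of depth `< k`. -/
def slots : ℕ → BT → List BT
  | 0, t => [t]
  | _ + 1, .leaf => [.leaf]
  | k + 1, .node l _ r => slots k l ++ slots k r

/-- The set `Z` of nodes of the tree of depth less than `k`. -/
noncomputable def shallowNodes (t : BT) (k : ℕ) : Finset ℝ :=
  (nodes t).filter fun x => (sig t x).length < k

/-- The list `X = x_1, …, x_{2^k − 1}` where `x_j` is the element of rank
`⌊j·|t| / 2^k⌋` in the sorted order of the values of `t`. -/
noncomputable def rankElems (t : BT) (k : ℕ) : List ℝ :=
  (List.range (2 ^ k - 1)).map fun j => (inorder t).getD ((j + 1) * size t / 2 ^ k) 0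

/-- The ordered list of trees obtained by applying `MultiSplit` to each tree of the
forest `t − Z`, each with the increasing list of the elements of `X` it contains. -/
noncomputable def balParts (t : BT) (k : ℕ) : List BT :=
  (slots k t).flatMap fun ti =>
    multiSplit ti ((inorder ti).filter fun x => x ∈ rankElems t k)

/-- `t` is a perfectly balanced binary search tree on the finite set `s`: its height
equals `⌊log₂ |t|⌋`. -/
def IsPerfBalBST (s : Finset ℝ) (t : BT) : Prop :=
  isBST t ∧ nodes t = s ∧ height t = Nat.log 2 (size t)

/-- `IsBalanceResult k tx s'` : `s'` is a possible result of applying `Balance(·, k)` to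
the (sub)tree `tx`: if `|tx| < 2^k`, `s'` is a perfectly balanced binary search tree on
the values of `tx`; otherwise `s'` is obtained by attaching, at the external positions
of a perfectly balanced binary search tree on `Z ∪ X`, the trees obtained by the
`MultiSplit`s of the trees of the forest `tx − Z`. -/
def IsBalanceResult (k : ℕ) (tx : BT) (s' : BT) : Prop :=
  if size tx < 2 ^ k then IsPerfBalBST (nodes tx) s'
  else
    ∃ t0 : BT,
      IsPerfBalBST (shallowNodes tx k ∪ (rankElems tx k).toFinset) t0 ∧
      s' = (glue t0 (balParts tx k)).1

/-- Replace the subtree rooted at the node holding `x` by `s`. -/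
noncomputable def replaceAt : BT → ℝ → BT → BT
  | .leaf, _, _ => .leaf
  | .node l v r, x, s =>
    if x < v then .node (replaceAt l x s) v r
    else if v < x then .node l v (replaceAt r x s)
    else s

/-- `BalanceRel t x k t'` : `t'` is a possible result of applying `Balance(x, k)` to `t`,
i.e. of replacing the subtree of `t` rooted at `x` by a result of `Balance(·, k)`. -/
def BalanceRel (t : BT) (x : ℝ) (k : ℕ) (t' : BT) : Prop :=
  ∃ s' : BT, IsBalanceResult k (subtreeAt t x) s' ∧ t' = replaceAt t x s'

/-- `BulkBalanceRel k θ t t'` : `t'` is a possible result of applying `BulkBalance(θ, k)`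
to `t`, i.e. of applying `Balance(x, k)` to every node `x` of depth `θ` in `t` (a no-op
if there is no such node). -/
def BulkBalanceRel (k : ℕ) : ℕ → BT → BT → Prop
  | 0, t, t' => (t = .leaf ∧ t' = .leaf) ∨ IsBalanceResult k t t'
  | _ + 1, .leaf, t' => t' = .leaf
  | θ + 1, .node l v r, t' =>
      ∃ l' r' : BT, BulkBalanceRel k θ l l' ∧ BulkBalanceRel k θ r r' ∧ t' = .node l' v r'

end BT

/-- `T 0, …, T q` is a one-phase `k`-bulk tree sequence: the node sets form a
1-chunking sequence of non-empty finite sets, and for each `y < q` one has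
`h(T_y) > y·(k+1)` and `T (y+1)` is obtained from `T y` by applying
`BulkBalance(y·(k+1), k)`, then `BulkInsert` of the new values, then `BulkDelete` of
the removed values. -/
def OnePhaseSeq (k q : ℕ) (T : ℕ → BT) : Prop :=
  (∀ y ≤ q, (T y).isBST) ∧
  (∀ y ≤ q, (T y).nodes.Nonempty) ∧
  (∀ y < q, Chunks 1 (T y).nodes (T (y + 1)).nodes ∧ Chunks 1 (T (y + 1)).nodes (T y).nodes) ∧
  (∀ y < q, (T y).height > y * (k + 1) ∧
    ∃ t₁ t₂ : BT,
      BT.BulkBalanceRel k (y * (k + 1)) (T y) t₁ ∧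
      BulkInsertRel t₁ ((T (y + 1)).nodes \ (T y).nodes) t₂ ∧
      BulkDeleteRel t₂ ((T y).nodes \ (T (y + 1)).nodes) (T (y + 1)))

namespace BT

/-- Number of levels. -/
def ht : BT → ℕ
  | .leaf => 0
  | .node l _ r => max (ht l) (ht r) + 1

/-- Maximum size of a subtree rooted at depth `d`. -/
def mx : ℕ → BT → ℕ
  | 0, t => size t
  | _ + 1, .leaf => 0
  | d + 1, .node l _ r => max (mx d l) (mx d r)

lemma mem_inorder (t : BT) (x : ℝ) : x ∈ inorder t ↔ x ∈ nodes t := by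
  induction t with
  | leaf => simp [inorder, nodes]
  | node l v r ihl ihr => simp [inorder, nodes, ihl, ihr]; tauto

lemma length_inorder (t : BT) : (inorder t).length = size t := by
  induction t with
  | leaf => simp [inorder, size]
  | node l v r ihl ihr => simp [inorder, size, ihl, ihr]; omega

lemma isBST_iff (t : BT) : isBST t ↔ (inorder t).Pairwise (· < ·) := by
  induction t with
  | leaf => simp [inorder, isBST]
  | node l v r ihl ihr =>
    simp only [inorder, isBST, ihl, ihr, List.pairwise_append, List.pairwise_cons, ← mem_inorder,
      List.mem_cons]
    constructor
    · rintro ⟨h1, h2, h3, h4⟩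
      refine ⟨h3, ⟨h2, h4⟩, ?_⟩
      rintro a ha b (rfl | hb)
      · exact h1 a ha
      · exact (h1 a ha).trans (h2 b hb)
    · rintro ⟨h3, ⟨h2, h4⟩, h⟩
      exact ⟨fun x hx => h x hx v (Or.inl rfl), h2, h3, h4⟩

lemma inorder_eq_of_nodes {t t' : BT} (h : isBST t) (h' : isBST t') (e : nodes t = nodes t') :
    inorder t = inorder t' := by
  rw [isBST_iff] at h h'
  refine List.Pairwise.eq_of_mem_iff h h' ?_
  intro x
  rw [mem_inorder, mem_inorder, e]

lemma card_nodes {t : BT} (h : isBST t) : (nodes t).card = size t := by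
  have h2 := h
  rw [isBST_iff] at h2
  have : nodes t = (inorder t).toFinset := by
    ext x; simp [mem_inorder]
  rw [this, List.toFinset_card_of_nodup (h2.imp ne_of_lt), length_inorder]

lemma sig_lt_ht' (t : BT) (hb : isBST t) (x : ℝ) (hx : x ∈ nodes t) :
    (sig t x).length + 1 ≤ ht t := by
  induction t with
  | leaf => simp [nodes] at hx
  | node l v r ihl ihr =>
    obtain ⟨h1, h2, h3, h4⟩ := hb
    simp only [nodes, Finset.mem_insert, Finset.mem_union] at hx
    simp only [sig, ht]
    rcases hx with rfl | hx | hx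
    · simp
    · have := ihl h3 hx
      simp [h1 x hx]; omega
    · have := ihr h4 hx
      have h := h2 x hx
      simp [h, h.not_gt]; omega

lemma exists_sig (t : BT) (hb : isBST t) (hne : t ≠ .leaf) :
    ∃ x ∈ nodes t, (sig t x).length + 1 = ht t := by
  induction t with
  | leaf => simp at hne
  | node l v r ihl ihr =>
    obtain ⟨h1, h2, h3, h4⟩ := hb
    rcases le_total (ht l) (ht r) with h | h
    · cases r with
      | leaf =>
        refine ⟨v, by simp [nodes], ?_⟩
        simp [ht] at h
        simp [sig, ht, h]
      | node a b c =>
        obtain ⟨x, hx, hs⟩ := ihr h4 (by simp)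
        refine ⟨x, by simp only [nodes, Finset.mem_insert, Finset.mem_union] at hx ⊢; tauto, ?_⟩
        have hv := h2 x hx
        rw [sig, ht]
        simp only [hv, hv.not_gt, if_true, if_false, List.length_cons]
        omega
    · cases l with
      | leaf =>
        refine ⟨v, by simp [nodes], ?_⟩
        simp [ht] at h
        simp [sig, ht, h]
      | node a b c =>
        obtain ⟨x, hx, hs⟩ := ihl h3 (by simp)
        refine ⟨x, by simp only [nodes, Finset.mem_insert, Finset.mem_union] at hx ⊢; tauto, ?_⟩
        have hv := h1 x hx
        rw [sig, ht]
        simp only [hv, if_true, List.length_cons]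
        omega

lemma height_eq (t : BT) (hb : isBST t) : height t = ht t - 1 := by
  unfold height
  apply le_antisymm
  · apply Finset.sup_le
    intro x hx
    have := sig_lt_ht' t hb x hx
    omega
  · by_cases h : t = .leaf
    · subst h; simp [ht]
    · obtain ⟨x, hx, hs⟩ := exists_sig t hb h
      rw [← hs, Nat.add_sub_cancel]
      exact Finset.le_sup (f := fun x => (sig t x).length) hx

lemma size_lt (t : BT) : size t < 2 ^ ht t := by
  induction t with
  | leaf => simp [size, ht]
  | node l v r ihl ihr =>
    simp only [size, ht, pow_succ]
    have a : 2 ^ ht l ≤ 2 ^ max (ht l) (ht r) := Nat.pow_le_pow_right (by norm_num) (by simp)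
    have b : 2 ^ ht r ≤ 2 ^ max (ht l) (ht r) := Nat.pow_le_pow_right (by norm_num) (by simp)
    omega

lemma subtreeAt_size_le (t : BT) (hb : isBST t) (x : ℝ) (hx : x ∈ nodes t) :
    size (subtreeAt t x) ≤ mx (sig t x).length t := by
  induction t with
  | leaf => simp [nodes] at hx
  | node l v r ihl ihr =>
    obtain ⟨h1, h2, h3, h4⟩ := hb
    simp only [nodes, Finset.mem_insert, Finset.mem_union] at hx
    simp only [sig, subtreeAt]
    rcases hx with rfl | hx | hx
    · simp [mx]
    · have := ihl h3 hx
      simp [h1 x hx, mx]; omega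
    · have := ihr h4 hx
      have h := h2 x hx
      simp [h, h.not_gt, mx]; omega

lemma mx_le_size (d : ℕ) (t : BT) : mx d t ≤ size t := by
  induction t generalizing d with
  | leaf => cases d <;> simp [mx, size]
  | node l v r ihl ihr =>
    cases d with
    | zero => simp [mx]
    | succ d =>
      have := ihl d
      have := ihr d
      simp only [mx, size]; omega

lemma mx_eq_zero (d : ℕ) (t : BT) (h : ht t ≤ d) : mx d t = 0 := by
  induction t generalizing d with
  | leaf => cases d <;> simp [mx, size]
  | node l v r ihl ihr =>
    cases d with
    | zero => simp [ht] at h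
    | succ d =>
      simp only [ht] at h
      have := ihl d (by omega)
      have := ihr d (by omega)
      simp only [mx]; omega

/-- Shape inclusion. -/
def Sh : BT → BT → Prop
  | .leaf, _ => True
  | .node _ _ _, .leaf => False
  | .node l _ r, .node l' _ r' => Sh l l' ∧ Sh r r'

lemma Sh.refl (t : BT) : Sh t t := by
  induction t with
  | leaf => trivial
  | node l v r ihl ihr => exact ⟨ihl, ihr⟩

lemma Sh.trans {a b c : BT} (h : Sh a b) (h' : Sh b c) : Sh a c := by
  induction a generalizing b c with
  | leaf => trivial
  | node l v r ihl ihr =>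
    cases b with
    | leaf => exact h.elim
    | node l' v' r' =>
      cases c with
      | leaf => exact h'.elim
      | node l'' v'' r'' => exact ⟨ihl h.1 h'.1, ihr h.2 h'.2⟩

lemma Sh.ht {a b : BT} (h : Sh a b) : ht a ≤ ht b := by
  induction a generalizing b with
  | leaf => simp [BT.ht]
  | node l v r ihl ihr =>
    cases b with
    | leaf => exact h.elim
    | node l' v' r' =>
      have := ihl h.1
      have := ihr h.2
      simp only [BT.ht]; omega

lemma Sh.size {a b : BT} (h : Sh a b) : size a ≤ size b := by
  induction a generalizing b with
  | leaf => simp [BT.size]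
  | node l v r ihl ihr =>
    cases b with
    | leaf => exact h.elim
    | node l' v' r' =>
      have := ihl h.1
      have := ihr h.2
      simp only [BT.size]; omega

lemma Sh.mx {a b : BT} (h : Sh a b) (d : ℕ) : mx d a ≤ mx d b := by
  induction d generalizing a b with
  | zero => exact h.size
  | succ d ih =>
    cases a with
    | leaf => simp [BT.mx]
    | node l v r =>
      cases b with
      | leaf => exact h.elim
      | node l' v' r' =>
        have := ih h.1
        have := ih h.2
        simp only [BT.mx]; omega

lemma sh_extractMax (t : BT) : ∀ m t', extractMax t = some (m, t') → Sh t' t := by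
  induction t with
  | leaf => intro m t' h; simp [extractMax] at h
  | node l v r ihl ihr =>
    intro m t' h
    cases r with
    | leaf =>
      rw [extractMax] at h
      cases e : extractMax l with
      | none =>
        rw [e] at h; simp at h
        rw [← h.2]; trivial
      | some p =>
        obtain ⟨m', l'⟩ := p
        rw [e] at h; simp at h
        rw [← h.2]
        exact ⟨ihl _ _ e, trivial⟩
    | node a b c =>
      rw [extractMax] at h
      cases e : extractMax (.node a b c) with
      | none =>
        cases c <;> simp only [extractMax] at e <;> split at e <;> simp at e
      | some p =>
        obtain ⟨m', l'⟩ := p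
        rw [e] at h; simp at h
        rw [← h.2]
        exact ⟨Sh.refl _, ihr _ _ e⟩

lemma sh_extractMin (t : BT) : ∀ m t', extractMin t = some (m, t') → Sh t' t := by
  induction t with
  | leaf => intro m t' h; simp [extractMin] at h
  | node l v r ihl ihr =>
    intro m t' h
    cases l with
    | leaf =>
      rw [extractMin] at h
      cases e : extractMin r with
      | none =>
        rw [e] at h; simp at h
        rw [← h.2]; trivial
      | some p =>
        obtain ⟨m', l'⟩ := p
        rw [e] at h; simp at h
        rw [← h.2]
        exact ⟨trivial, ihr _ _ e⟩
    | node a b c =>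
      rw [extractMin] at h
      cases e : extractMin (.node a b c) with
      | none =>
        cases a <;> simp only [extractMin] at e <;> split at e <;> simp at e
      | some p =>
        obtain ⟨m', l'⟩ := p
        rw [e] at h; simp at h
        rw [← h.2]
        exact ⟨ihl _ _ e, Sh.refl _⟩

lemma sh_delete (t : BT) (x : ℝ) : Sh (delete t x) t := by
  induction t with
  | leaf => trivial
  | node l v r ihl ihr =>
    rw [delete]
    split_ifs
    · exact ⟨ihl, Sh.refl _⟩
    · exact ⟨Sh.refl _, ihr⟩
    · cases e : extractMax l with
      | some p =>
        obtain ⟨m, l'⟩ := p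
        exact ⟨sh_extractMax _ _ _ e, Sh.refl _⟩
      | none =>
        cases e' : extractMin r with
        | some p =>
          obtain ⟨m, r'⟩ := p
          exact ⟨trivial, sh_extractMin _ _ _ e'⟩
        | none => trivial

lemma sh_bulkDelete (xs : List ℝ) (t : BT) : Sh (xs.foldl delete t) t := by
  induction xs generalizing t with
  | nil => exact Sh.refl _
  | cons x xs ih => exact (ih _).trans (sh_delete t x)

/-- Shape relation after a bulk insertion of at most one value per external position. -/
def InsSh : BT → BT → Prop
  | .leaf, .leaf => True
  | .leaf, .node .leaf _ .leaf => True
  | .leaf, _ => False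
  | .node _ _ _, .leaf => False
  | .node l _ r, .node l' _ r' => InsSh l l' ∧ InsSh r r'

lemma InsSh.leaf {b : BT} (h : InsSh .leaf b) : b = .leaf ∨ ∃ x, b = .node .leaf x .leaf := by
  rcases b with _ | ⟨_ | _, v, _ | _⟩ <;> simp [InsSh] at h ⊢

lemma InsSh.ht {a b : BT} (h : InsSh a b) : ht b ≤ ht a + 1 := by
  induction a generalizing b with
  | leaf => rcases h.leaf with rfl | ⟨x, rfl⟩ <;> simp [BT.ht]
  | node l v r ihl ihr =>
    cases b with
    | leaf => simp [BT.ht]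
    | node l' v' r' =>
      simp only [InsSh] at h
      have := ihl h.1
      have := ihr h.2
      simp only [BT.ht]; omega

lemma InsSh.size {a b : BT} (h : InsSh a b) : size b ≤ 2 * size a + 1 := by
  induction a generalizing b with
  | leaf => rcases h.leaf with rfl | ⟨x, rfl⟩ <;> simp [BT.size]
  | node l v r ihl ihr =>
    cases b with
    | leaf => simp [BT.size]
    | node l' v' r' =>
      simp only [InsSh] at h
      have := ihl h.1
      have := ihr h.2
      simp only [BT.size]; omega

lemma InsSh.mx {a b : BT} (h : InsSh a b) (d : ℕ) : mx d b ≤ 2 * mx d a + 1 := by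
  induction d generalizing a b with
  | zero => exact h.size
  | succ d ih =>
    cases a with
    | leaf =>
      refine (mx_le_size _ _).trans ?_
      have := h.size
      simp only [BT.size] at this
      omega
    | node l v r =>
      cases b with
      | leaf => simp [BT.mx]
      | node l' v' r' =>
        simp only [InsSh] at h
        have := ih h.1
        have := ih h.2
        simp only [BT.mx]; omega

lemma foldl_ins_node_s12 (xs : List ℝ) (l r : BT) (v : ℝ) :
    xs.foldl ins (.node l v r) =
      .node ((xs.filter (fun x => x < v)).foldl ins l) v
        ((xs.filter (fun x => v < x)).foldl ins r) := by
  induction xs generalizing l r with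
  | nil => simp
  | cons x xs ih =>
    rw [List.foldl_cons, ins]
    split_ifs with h1 h2
    · rw [ih]; simp [h1, h1.not_gt]
    · rw [ih]; simp [h2, h1]
    · rw [ih]; simp [h2, h1]

lemma insSh_foldl (t : BT) (hb : isBST t) (xs : List ℝ) (hn : xs.Nodup)
    (hx : ∀ a ∈ xs, ∀ b ∈ xs, a < b → ∃ s ∈ nodes t, a < s ∧ s < b) :
    InsSh t (xs.foldl ins t) := by
  induction t generalizing xs with
  | leaf =>
    match xs, hn, hx with
    | [], _, _ => simp [InsSh]
    | [x], _, _ => simp [InsSh, ins]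
    | x :: y :: xs, hn, hx =>
      exfalso
      have hne : x ≠ y := by rintro rfl; simp at hn
      rcases lt_or_gt_of_ne hne with h | h
      · obtain ⟨s, hs, _⟩ := hx x (by simp) y (by simp) h
        simp [nodes] at hs
      · obtain ⟨s, hs, _⟩ := hx y (by simp) x (by simp) h
        simp [nodes] at hs
  | node l v r ihl ihr =>
    rw [foldl_ins_node_s12]
    obtain ⟨h1, h2, h3, h4⟩ := hb
    refine ⟨ihl h3 _ (hn.filter _) ?_, ihr h4 _ (hn.filter _) ?_⟩
    · intro a ha b hb hab
      simp only [List.mem_filter, decide_eq_true_eq] at ha hb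
      obtain ⟨s, hs, hs1, hs2⟩ := hx a ha.1 b hb.1 hab
      refine ⟨s, ?_, hs1, hs2⟩
      simp only [nodes, Finset.mem_insert, Finset.mem_union] at hs
      rcases hs with rfl | hs | hs
      · exact absurd hs2 hb.2.not_gt
      · exact hs
      · exact absurd (hs2.trans hb.2) (h2 s hs).not_gt
    · intro a ha b hb hab
      simp only [List.mem_filter, decide_eq_true_eq] at ha hb
      obtain ⟨s, hs, hs1, hs2⟩ := hx a ha.1 b hb.1 hab
      refine ⟨s, ?_, hs1, hs2⟩
      simp only [nodes, Finset.mem_insert, Finset.mem_union] at hs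
      rcases hs with rfl | hs | hs
      · exact absurd hs1 ha.2.not_gt
      · exact absurd (ha.2.trans hs1) (h1 s hs).not_gt
      · exact hs

/-- `Dec ps ws L`: the list `L` is the concatenation of the in-order lists of the trees `ps`
interleaved with the separators `ws`. -/
inductive Dec : List BT → List ℝ → List ℝ → Prop
  | single (p : BT) : Dec [p] [] (inorder p)
  | cons (p : BT) (w : ℝ) {ps : List BT} {ws L : List ℝ} (h : Dec ps ws L) :
      Dec (p :: ps) (w :: ws) (inorder p ++ w :: L)

lemma Dec.append {ps₁ ps₂ : List BT} {ws₁ ws₂ L₁ L₂ : List ℝ} (h₁ : Dec ps₁ ws₁ L₁)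
    (w : ℝ) (h₂ : Dec ps₂ ws₂ L₂) : Dec (ps₁ ++ ps₂) (ws₁ ++ w :: ws₂) (L₁ ++ w :: L₂) := by
  induction h₁ with
  | single p => exact Dec.cons p w h₂
  | cons p w' h ih =>
    have := Dec.cons p w' ih
    simpa using this

lemma Dec.sublist {ps : List BT} {ws L : List ℝ} (h : Dec ps ws L) : ws.Sublist L := by
  induction h with
  | single p => simp
  | cons p w h ih => exact (ih.cons_cons w).trans (List.sublist_append_right _ _)

lemma Dec.middle {ps : List BT} {ws L : List ℝ} (h : Dec ps ws L) (p : BT) (hp : p ∈ ps) :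
    ∃ A B, L = A ++ inorder p ++ B ∧ (∀ w ∈ ws, w ∈ A ∨ w ∈ B) := by
  induction h with
  | single q =>
    simp only [List.mem_singleton] at hp
    subst hp
    exact ⟨[], [], by simp, by simp⟩
  | @cons q w ps ws L h ih =>
    rcases List.mem_cons.1 hp with rfl | hp
    · refine ⟨[], w :: L, by simp, ?_⟩
      intro z hz
      right
      exact (h.sublist.cons_cons w).subset hz
    · obtain ⟨A, B, rfl, hw⟩ := ih hp
      refine ⟨inorder q ++ w :: A, B, by simp, ?_⟩
      intro z hz
      rcases List.mem_cons.1 hz with rfl | hz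
      · left; simp
      · rcases hw z hz with h | h
        · left; simp [h]
        · right; exact h

lemma inorder_split (t : BT) (hb : isBST t) (x : ℝ) (hx : x ∈ nodes t) :
    inorder t = inorder (split t x).1 ++ x :: inorder (split t x).2 := by
  induction t with
  | leaf => simp [nodes] at hx
  | node l v r ihl ihr =>
    obtain ⟨h1, h2, h3, h4⟩ := hb
    simp only [nodes, Finset.mem_insert, Finset.mem_union] at hx
    rw [split]
    rcases hx with rfl | hx | hx
    · simp [inorder]
    · have := h1 x hx
      simp [this, inorder, ihl h3 hx]
    · have h := h2 x hx
      simp [h, h.not_gt, inorder]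
      rw [ihr h4 hx]

lemma ht_split (t : BT) (x : ℝ) : ht (split t x).1 ≤ ht t ∧ ht (split t x).2 ≤ ht t := by
  induction t with
  | leaf => simp [split, ht]
  | node l v r ihl ihr =>
    rw [split]
    split_ifs <;> simp only [ht] <;> omega

lemma multiSplit_spec (n : ℕ) : ∀ (xs : List ℝ), xs.length ≤ n → ∀ (t : BT), isBST t →
    xs.Pairwise (· < ·) → (∀ x ∈ xs, x ∈ nodes t) → Dec (multiSplit t xs) xs (inorder t) := by
  induction n with
  | zero =>
    intro xs hxs t hb hp hm
    have : xs = [] := by simpa using hxs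
    subst this
    rw [multiSplit]; exact Dec.single t
  | succ n ih =>
    intro xs hxs t hb hp hm
    match xs, hxs, hp, hm with
    | [], _, _, _ => rw [multiSplit]; exact Dec.single t
    | x₀ :: xs', hxs, hp, hm =>
      rw [multiSplit]
      generalize hys : x₀ :: xs' = ys at *
      have hlen : 0 < ys.length := by rw [← hys]; simp
      clear hys
      set m := (ys.length + 1) / 2 - 1 with hmdef
      have hm1 : (ys.length + 1) / 2 = m + 1 := by omega
      have hml : m < ys.length := by omega
      rw [hm1]
      have hget : ys.getD m 0 = ys[m] := by simp [hml]
      rw [hget]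
      have hdec : ys = ys.take m ++ ys[m] :: ys.drop (m + 1) := by simp
      set x := ys[m] with hxdef
      have hxt : x ∈ nodes t := hm _ (by simp [hxdef])
      have hsp := inorder_split t hb x hxt
      have hp2 := hp
      rw [hdec, List.pairwise_append, List.pairwise_cons] at hp2
      obtain ⟨hpa, ⟨hpb, hpc⟩, hpd⟩ := hp2
      have hb2 := hb
      rw [isBST_iff, hsp, List.pairwise_append, List.pairwise_cons] at hb2
      obtain ⟨hba, ⟨hbb, hbc⟩, hbd⟩ := hb2
      have hmm : ∀ z ∈ ys, z ∈ inorder (split t x).1 ++ x :: inorder (split t x).2 := by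
        intro z hz
        rw [← hsp, mem_inorder]; exact hm z hz
      rw [hsp]
      conv => arg 2; rw [hdec]
      refine Dec.append (ih _ ?_ _ ?_ hpa ?_) x (ih _ ?_ _ ?_ hpc ?_)
      · rw [List.length_take]; omega
      · rw [isBST_iff]; exact hba
      · intro z hz
        have hzx : z < x := hpd z hz x (by simp)
        have := hmm z (List.mem_of_mem_take hz)
        simp only [List.mem_append, List.mem_cons] at this
        rcases this with h | h | h
        · rwa [← mem_inorder]
        · exact absurd h hzx.ne
        · exact absurd hzx (hbb z h).not_gt
      · rw [List.length_drop]; omega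
      · rw [isBST_iff]; exact hbc
      · intro z hz
        have hzx : x < z := hpb z hz
        have := hmm z (List.mem_of_mem_drop hz)
        simp only [List.mem_append, List.mem_cons] at this
        rcases this with h | h | h
        · exact absurd hzx (hbd z h x (by simp)).not_gt
        · exact absurd h hzx.ne'
        · rwa [← mem_inorder]

lemma ht_multiSplit (n : ℕ) : ∀ (xs : List ℝ), xs.length ≤ n → ∀ (t : BT),
    ∀ p ∈ multiSplit t xs, ht p ≤ ht t := by
  induction n with
  | zero =>
    intro xs hxs t p hp
    have : xs = [] := by simpa using hxs
    subst this
    rw [multiSplit] at hp; simp at hp; rw [hp]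
  | succ n ih =>
    intro xs hxs t p hp
    match xs, hxs, hp with
    | [], _, hp => rw [multiSplit] at hp; simp at hp; rw [hp]
    | x₀ :: xs', hxs, hp =>
      rw [multiSplit, List.mem_append] at hp
      simp only [List.length_cons] at hxs
      rcases hp with hp | hp
      · refine (ih _ ?_ _ p hp).trans (ht_split _ _).1
        simp only [List.length_take, List.length_cons]; omega
      · refine (ih _ ?_ _ p hp).trans (ht_split _ _).2
        simp only [List.length_drop, List.length_cons]; omega

lemma ht_slots (k : ℕ) (t : BT) : ∀ p ∈ slots k t, ht p ≤ ht t - k := by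
  induction k generalizing t with
  | zero => intro p hp; simp [slots] at hp; simp [hp]
  | succ k ih =>
    intro p hp
    cases t with
    | leaf => simp [slots] at hp; simp [hp, ht]
    | node l v r =>
      rw [slots, List.mem_append] at hp
      rw [ht]
      rcases hp with hp | hp
      · have := ih _ p hp; omega
      · have := ih _ p hp; omega

lemma ht_balParts (t : BT) (k : ℕ) : ∀ p ∈ balParts t k, ht p ≤ ht t - k := by
  intro p hp
  rw [balParts, List.mem_flatMap] at hp
  obtain ⟨s, hs, hp⟩ := hp
  exact (ht_multiSplit _ _ le_rfl _ p hp).trans (ht_slots k t s hs)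

lemma parts_spec (P : ℝ → Prop) (k : ℕ) (t : BT) (hb : isBST t) :
    ∃ W, Dec ((slots k t).flatMap fun ti => multiSplit ti ((inorder ti).filter fun x => P x)) W
      (inorder t) ∧ ∀ x, x ∈ W ↔ x ∈ nodes t ∧ ((sig t x).length < k ∨ P x) := by
  induction k generalizing t with
  | zero =>
    refine ⟨(inorder t).filter fun x => P x, ?_, ?_⟩
    · simp only [slots, List.flatMap_cons, List.flatMap_nil, List.append_nil]
      refine multiSplit_spec _ _ le_rfl t hb ?_ ?_
      · exact ((isBST_iff t).1 hb).filter _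
      · intro x hx
        rw [List.mem_filter, mem_inorder] at hx
        exact hx.1
    · intro x
      simp [mem_inorder]
  | succ k ih =>
    cases t with
    | leaf =>
      refine ⟨[], ?_, by simp [nodes]⟩
      simp only [slots, List.flatMap_cons, List.flatMap_nil, List.append_nil, inorder,
        List.filter_nil]
      rw [multiSplit]
      exact Dec.single _
    | node l v r =>
      obtain ⟨h1, h2, h3, h4⟩ := hb
      obtain ⟨W₁, hd1, hw1⟩ := ih l h3
      obtain ⟨W₂, hd2, hw2⟩ := ih r h4
      refine ⟨W₁ ++ v :: W₂, ?_, ?_⟩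
      · rw [slots, List.flatMap_append]
        exact hd1.append v hd2
      · intro x
        simp only [List.mem_append, List.mem_cons, hw1, hw2, nodes, Finset.mem_insert,
          Finset.mem_union, sig]
        rcases lt_trichotomy x v with h | h | h
        · have hr : x ∉ nodes r := fun hx => absurd h (h2 x hx).not_gt
          simp [h, h.ne, hr]
        · subst h
          simp
        · have hl : x ∉ nodes l := fun hx => absurd h (h1 x hx).not_gt
          simp [h, h.ne', hl, h.not_gt]

lemma glue_dec (t : BT) : ∀ (ps : List BT) (ws L : List ℝ), Dec ps (inorder t ++ ws) L →
    (ws = [] → inorder (glue t ps).1 = L) ∧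
    (∀ w ws', ws = w :: ws' → ∃ L', Dec (glue t ps).2 ws' L' ∧
      L = inorder (glue t ps).1 ++ w :: L') := by
  induction t with
  | leaf =>
    intro ps ws L h
    simp only [inorder, List.nil_append] at h
    constructor
    · rintro rfl
      cases h
      simp [glue]
    · rintro w ws' rfl
      cases h with
      | cons p w h => exact ⟨_, h, by simp [glue]⟩
  | node l v r ihl ihr =>
    intro ps ws L h
    simp only [inorder, List.append_assoc, List.cons_append] at h
    obtain ⟨L', hd, rfl⟩ := (ihl _ _ _ h).2 _ _ rfl
    obtain ⟨hr1, hr2⟩ := ihr _ _ _ hd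
    constructor
    · intro hw
      have := hr1 hw
      simp [glue, inorder, this]
    · intro w ws' hw
      obtain ⟨L'', hd', rfl⟩ := hr2 w ws' hw
      exact ⟨L'', by simpa [glue] using hd', by simp [glue, inorder]⟩

lemma glue_tail (t : BT) (ps : List BT) : ∀ p ∈ (glue t ps).2, p ∈ ps := by
  induction t generalizing ps with
  | leaf => intro p hp; simp only [glue] at hp; exact List.mem_of_mem_tail hp
  | node l v r ihl ihr => intro p hp; simp only [glue] at hp; exact ihl _ _ (ihr _ _ hp)

lemma glue_ht (t : BT) (ps : List BT) (B : ℕ) (h : ∀ p ∈ ps, ht p ≤ B) :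
    ht (glue t ps).1 ≤ ht t + B := by
  induction t generalizing ps with
  | leaf =>
    cases ps with
    | nil => simp [glue, ht]
    | cons p ps => simpa [glue, ht] using h p (by simp)
  | node l v r ihl ihr =>
    have := ihl ps h
    have := ihr (glue l ps).2 (fun p hp => h p (glue_tail _ _ p hp))
    simp only [glue, ht]; omega

lemma glue_mx (t : BT) (ps : List BT) (B d : ℕ) (h : ∀ p ∈ ps, size p ≤ B) (hd : ht t ≤ d) :
    mx d (glue t ps).1 ≤ B := by
  induction t generalizing ps d with
  | leaf =>
    refine (mx_le_size _ _).trans ?_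
    cases ps with
    | nil => simp [glue, size]
    | cons p ps => simpa [glue] using h p (by simp)
  | node l v r ihl ihr =>
    cases d with
    | zero => simp [ht] at hd
    | succ d =>
      simp only [ht] at hd
      have := ihl ps d h (by omega)
      have := ihr (glue l ps).2 d (fun p hp => h p (glue_tail _ _ p hp)) (by omega)
      simp only [glue, mx]; omega

lemma card_shallow (t : BT) (hb : isBST t) (k : ℕ) : (shallowNodes t k).card + 1 ≤ 2 ^ k := by
  induction k generalizing t with
  | zero => simp [shallowNodes]
  | succ k ih =>
    cases t with
    | leaf => simp [shallowNodes, nodes, Nat.one_le_two_pow]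
    | node l v r =>
      obtain ⟨h1, h2, h3, h4⟩ := hb
      have hsub : shallowNodes (.node l v r) (k + 1) ⊆
          insert v (shallowNodes l k ∪ shallowNodes r k) := by
        intro x hx
        rw [shallowNodes, Finset.mem_filter] at hx
        rw [Finset.mem_insert, Finset.mem_union, shallowNodes, shallowNodes, Finset.mem_filter,
          Finset.mem_filter]
        simp only [nodes, Finset.mem_insert, Finset.mem_union, sig] at hx
        obtain ⟨hx | hx | hx, hs⟩ := hx
        · exact Or.inl hx
        · have h := h1 x hx
          simp [h] at hs
          exact Or.inr (Or.inl ⟨hx, hs⟩)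
        · have h := h2 x hx
          simp [h, h.not_gt] at hs
          exact Or.inr (Or.inr ⟨hx, hs⟩)
      have c1 := Finset.card_le_card hsub
      have c2 := Finset.card_insert_le v (shallowNodes l k ∪ shallowNodes r k)
      have c3 := Finset.card_union_le (shallowNodes l k) (shallowNodes r k)
      have := ih l h3
      have := ih r h4
      rw [pow_succ]; omega

lemma arith_gap (K n a m : ℕ) (hK : 0 < K) (ham : a + m ≤ n)
    (h : ∀ j, j + 1 < K → (j + 1) * n / K < a ∨ a + m ≤ (j + 1) * n / K) : m * K ≤ n := by
  have hex : ∃ j, a * K ≤ (j + 1) * n := by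
    refine ⟨K - 1, ?_⟩
    rw [Nat.sub_add_cancel hK, mul_comm]
    exact Nat.mul_le_mul_left _ (by omega)
  classical
  set j := Nat.find hex with hj
  have h1 : a * K ≤ (j + 1) * n := Nat.find_spec hex
  have h2 : j * n ≤ a * K := by
    by_cases h0 : j = 0
    · simp [h0]
    · have := Nat.find_min hex (m := j - 1) (by omega)
      rw [Nat.sub_add_cancel (by omega)] at this
      omega
  have h3 : (a + m) * K ≤ (j + 1) * n := by
    by_cases hjK : j + 1 < K
    · rcases h j hjK with h' | h'
      · rw [Nat.div_lt_iff_lt_mul hK] at h'; omega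
      · exact (Nat.le_div_iff_mul_le hK).1 h'
    · calc (a + m) * K ≤ n * K := Nat.mul_le_mul_right _ ham
        _ = K * n := mul_comm _ _
        _ ≤ (j + 1) * n := Nat.mul_le_mul_right _ (by omega)
  nlinarith

lemma rankElems_mem (t : BT) (k : ℕ) (x : ℝ) (hs : 2 ^ k ≤ size t) (hx : x ∈ rankElems t k) :
    x ∈ nodes t := by
  simp only [rankElems, List.mem_map, List.mem_range] at hx
  obtain ⟨j, hj, rfl⟩ := hx
  have hK : 0 < 2 ^ k := Nat.two_pow_pos k
  have hlt : (j + 1) * size t / 2 ^ k < (inorder t).length := by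
    rw [length_inorder, Nat.div_lt_iff_lt_mul hK, mul_comm (size t)]
    exact Nat.mul_lt_mul_of_pos_right (by omega) (by omega)
  rw [← mem_inorder]
  simp [hlt]

lemma part_size (t : BT) (hb : isBST t) (k : ℕ) (hs : 2 ^ k ≤ size t) (ps : List BT)
    (W : List ℝ) (hd : Dec ps W (inorder t)) (hW : ∀ x ∈ rankElems t k, x ∈ W) :
    ∀ p ∈ ps, size p * 2 ^ k ≤ size t := by
  intro p hp
  obtain ⟨A, B, hL, hw⟩ := hd.middle p hp
  have hK : 0 < 2 ^ k := Nat.two_pow_pos k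
  have hnd : (inorder t).Nodup := ((isBST_iff t).1 hb).imp ne_of_lt
  have hlen : size t = A.length + size p + B.length := by
    rw [← length_inorder t, hL]; simp [length_inorder]; omega
  refine arith_gap (2 ^ k) (size t) A.length (size p) hK (by omega) ?_
  intro j hj
  by_contra hcon
  push Not at hcon
  obtain ⟨hc1, hc2⟩ := hcon
  set i := (j + 1) * size t / 2 ^ k with hi
  have hil : i < (inorder t).length := by rw [length_inorder]; omega
  have hmem : (inorder t)[i] ∈ rankElems t k := by
    simp only [rankElems, List.mem_map, List.mem_range]
    refine ⟨j, by omega, ?_⟩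
    rw [← hi]; simp [hil]
  have hpm : (inorder t)[i] ∈ inorder p := by
    have e : (inorder t)[i] = (A ++ inorder p ++ B)[i]'(by rw [← hL]; exact hil) := by
      simp only [hL]
    rw [e, List.getElem_append_left (by simp [length_inorder]; omega),
      List.getElem_append_right hc1]
    exact List.getElem_mem _
  rw [hL, List.append_assoc] at hnd
  have hdis := List.nodup_append.1 hnd
  have hdis2 := List.nodup_append.1 hdis.2.1
  rcases hw _ (hW _ hmem) with h | h
  · exact hdis.2.2 _ h _ (by simp [hpm]) rfl
  · exact hdis2.2.2 _ hpm _ h rfl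

/-- Properties of a single balance. -/
lemma balance_spec (k : ℕ) (hk : 1 ≤ k) (t t' : BT) (hb : isBST t)
    (h : IsBalanceResult k t t') :
    inorder t' = inorder t ∧ ht t' ≤ ht t + 1 ∧
      (ht t' ≤ k ∨ (2 ^ k ≤ size t ∧ mx (k + 1) t' * 2 ^ k ≤ size t)) := by
  unfold IsBalanceResult at h
  split_ifs at h with hs
  · obtain ⟨hb', hn, hh⟩ := h
    have hsz : size t' = size t := by rw [← card_nodes hb', ← card_nodes hb, hn]
    rw [height_eq _ hb', hsz] at hh
    refine ⟨inorder_eq_of_nodes hb' hb hn, ?_, Or.inl ?_⟩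
    · by_cases h0 : size t = 0
      · rw [h0] at hh; simp at hh; omega
      · have := Nat.log_lt_of_lt_pow h0 (size_lt t)
        omega
    · by_cases h0 : size t = 0
      · rw [h0] at hh; simp at hh; omega
      · have := Nat.log_lt_of_lt_pow h0 hs
        omega
  · push Not at hs
    obtain ⟨t0, ⟨hb0, hn0, hh0⟩, rfl⟩ := h
    obtain ⟨W, hd, hW⟩ := parts_spec (fun x => x ∈ rankElems t k) k t hb
    replace hd : Dec (balParts t k) W (inorder t) := by
      unfold balParts
      convert hd
    have hWs : W.Pairwise (· < ·) := ((isBST_iff t).1 hb).sublist hd.sublist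
    have hin : inorder t0 = W := by
      refine List.Pairwise.eq_of_mem_iff ((isBST_iff t0).1 hb0) hWs ?_
      intro x
      rw [mem_inorder, hn0, hW, shallowNodes]
      simp only [Finset.mem_union, Finset.mem_filter, List.mem_toFinset]
      constructor
      · rintro (h | h)
        · exact ⟨h.1, Or.inl h.2⟩
        · exact ⟨rankElems_mem t k x hs h, Or.inr h⟩
      · rintro ⟨h1, h2 | h2⟩
        · exact Or.inl ⟨h1, h2⟩
        · exact Or.inr h2
    have hd' : Dec (balParts t k) (inorder t0 ++ []) (inorder t) := by
      rw [List.append_nil, hin]; exact hd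
    have ht0 : ht t0 ≤ k + 1 := by
      rw [height_eq _ hb0, ← card_nodes hb0, hn0] at hh0
      have c1 := Finset.card_union_le (shallowNodes t k) (rankElems t k).toFinset
      have c2 := card_shallow t hb k
      have c3 := List.toFinset_card_le (rankElems t k)
      have c4 : (rankElems t k).length = 2 ^ k - 1 := by simp [rankElems]
      have c5 : Nat.log 2 (shallowNodes t k ∪ (rankElems t k).toFinset).card < k + 1 := by
        refine Nat.log_lt_of_lt_pow' (by omega) ?_
        rw [pow_succ]; omega
      omega
    refine ⟨(glue_dec t0 _ _ _ hd').1 rfl, ?_, Or.inr ⟨hs, ?_⟩⟩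
    · have h1 := glue_ht t0 (balParts t k) _ (ht_balParts t k)
      have h2 : k < ht t := (Nat.pow_lt_pow_iff_right (a := 2) (by norm_num)).1
        (hs.trans_lt (size_lt t))
      omega
    · have hps := part_size t hb k hs _ W hd (fun x hx => (hW x).2
        ⟨rankElems_mem t k x hs hx, Or.inr hx⟩)
      have := glue_mx t0 (balParts t k) (size t / 2 ^ k) (k + 1)
        (fun p hp => (Nat.le_div_iff_mul_le (Nat.two_pow_pos k)).2 (hps p hp)) ht0
      exact (Nat.le_div_iff_mul_le (Nat.two_pow_pos k)).1 this

lemma bulkBalance_inorder (k : ℕ) (hk : 1 ≤ k) (θ : ℕ) (t t' : BT) (hb : isBST t)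
    (h : BulkBalanceRel k θ t t') : inorder t' = inorder t ∧ ht t' ≤ ht t + 1 := by
  induction θ generalizing t t' with
  | zero =>
    rcases h with ⟨rfl, rfl⟩ | h
    · simp
    · have := balance_spec k hk t t' hb h
      exact ⟨this.1, this.2.1⟩
  | succ θ ih =>
    cases t with
    | leaf => simp only [BulkBalanceRel] at h; subst h; simp
    | node l v r =>
      obtain ⟨l', r', hl, hr, rfl⟩ := h
      obtain ⟨_, _, h3, h4⟩ := hb
      obtain ⟨a1, a2⟩ := ih l l' h3 hl
      obtain ⟨b1, b2⟩ := ih r r' h4 hr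
      refine ⟨by simp [inorder, a1, b1], ?_⟩
      simp only [ht]; omega

lemma bulkBalance_mx (k : ℕ) (hk : 1 ≤ k) (θ : ℕ) (t t' t'' : BT) (hb : isBST t)
    (h : BulkBalanceRel k θ t t') (hi : InsSh t' t'') :
    mx (θ + (k + 1)) t'' * 2 ^ k ≤ 4 * mx θ t := by
  induction θ generalizing t t' t'' with
  | zero =>
    have key : ht t' ≤ k ∨ (2 ^ k ≤ size t ∧ mx (k + 1) t' * 2 ^ k ≤ size t) := by
      rcases h with ⟨rfl, rfl⟩ | h
      · left; simp [ht]
      · exact (balance_spec k hk t t' hb h).2.2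
    rw [zero_add, mx]
    rcases key with h | ⟨h1, h2⟩
    · have := hi.ht
      rw [mx_eq_zero _ _ (by omega)]; simp
    · have := hi.mx (k + 1)
      have := Nat.mul_le_mul_right (2 ^ k) this
      nlinarith
  | succ θ ih =>
    cases t with
    | leaf =>
      simp only [BulkBalanceRel] at h; subst h
      have := hi.ht
      rw [mx_eq_zero _ _ (by simp only [ht] at this; omega)]; simp
    | node l v r =>
      obtain ⟨l', r', hl, hr, rfl⟩ := h
      obtain ⟨_, _, h3, h4⟩ := hb
      cases t'' with
      | leaf => rw [mx_eq_zero _ _ (by simp [ht])]; simp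
      | node l'' v'' r'' =>
        simp only [InsSh] at hi
        have a := ih l l' l'' h3 hl hi.1
        have b := ih r r' r'' h4 hr hi.2
        rw [show θ + 1 + (k + 1) = (θ + (k + 1)) + 1 by omega, mx, mx]
        rcases le_total (mx (θ + (k + 1)) l'') (mx (θ + (k + 1)) r'') with h | h
        · rw [max_eq_right h]; omega
        · rw [max_eq_left h]; omega

lemma step_spec (k : ℕ) (hk : 1 ≤ k) (θ : ℕ) (t t₁ t₂ t₃ : BT) (hb : isBST t)
    (hc : Chunks 1 t.nodes t₃.nodes)
    (h1 : BulkBalanceRel k θ t t₁) (h2 : BulkInsertRel t₁ (t₃.nodes \ t.nodes) t₂)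
    (h3 : BulkDeleteRel t₂ (t.nodes \ t₃.nodes) t₃) :
    ht t₃ ≤ ht t + 2 ∧ mx (θ + (k + 1)) t₃ * 2 ^ k ≤ 4 * mx θ t := by
  obtain ⟨e1, e2⟩ := bulkBalance_inorder k hk θ t t₁ hb h1
  have hb1 : isBST t₁ := by rw [isBST_iff, e1, ← isBST_iff]; exact hb
  have hn1 : ∀ x, x ∈ nodes t₁ ↔ x ∈ nodes t := by
    intro x; rw [← mem_inorder, e1, mem_inorder]
  obtain ⟨xs, hnd, hxs, e⟩ := h2
  have hi : InsSh t₁ t₂ := by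
    rw [e]
    refine insSh_foldl t₁ hb1 xs hnd ?_
    intro a ha b hb' hab
    rw [← List.mem_toFinset, hxs, Finset.mem_sdiff] at ha hb'
    obtain ⟨x, hx, ⟨s, hs, hsx⟩, ⟨s', hs', hxs'⟩⟩ := hc {a, b} (by
      intro z hz
      simp only [Finset.mem_insert, Finset.mem_singleton] at hz
      rcases hz with rfl | rfl
      · exact ha.1
      · exact hb'.1) (Finset.card_pair hab.ne)
    simp only [Finset.mem_insert, Finset.mem_singleton] at hs hs'
    have hxa : x ≠ a := by rintro rfl; exact ha.2 hx
    have hxb : x ≠ b := by rintro rfl; exact hb'.2 hx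
    have h1 : a ≤ x := by
      rcases hs with rfl | rfl
      · exact hsx
      · exact hab.le.trans hsx
    have h2 : x ≤ b := by
      rcases hs' with rfl | rfl
      · exact hxs'.trans hab.le
      · exact hxs'
    exact ⟨x, (hn1 x).2 hx, lt_of_le_of_ne h1 hxa.symm, lt_of_le_of_ne h2 hxb⟩
  obtain ⟨ys, _, _, e'⟩ := h3
  have hsh : Sh t₃ t₂ := by
    have := sh_bulkDelete ys t₂
    rwa [← e'] at this
  constructor
  · have := hsh.ht
    have := hi.ht
    omega
  · exact (Nat.mul_le_mul_right _ (hsh.mx _)).trans (bulkBalance_mx k hk θ t t₁ t₂ hb h1 hi)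

end BT

/-- invariants of one-phase bulk tree sequences: for a one-phase
`k`-bulk tree sequence `T_0, …, T_q` with `k ≥ 5`, for each `y ≤ q`:
(1) `h(T_y) ≤ h(T_0) + 2y`; and (2) every subtree of `T_y` rooted at a node of depth
`y·(k+1)` has size at most `|T_0|·2^{−y(k−2)}`. -/
theorem one_phase_invariants (k q : ℕ) (hk : 5 ≤ k) (T : ℕ → BT)
    (hseq : OnePhaseSeq k q T) :
    ∀ y ≤ q,
      (T y).height ≤ (T 0).height + 2 * y ∧
      ∀ x ∈ (T y).nodes, ((T y).sig x).length = y * (k + 1) →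
        (((T y).subtreeAt x).size : ℝ) ≤
          ((T 0).size : ℝ) * 2 ^ (-((y * (k - 2) : ℕ) : ℤ)) := by
  obtain ⟨hbst, hne, hch, hst⟩ := hseq
  have main : ∀ y ≤ q, (T y).ht ≤ (T 0).ht + 2 * y ∧
      (BT.mx (y * (k + 1)) (T y)) * 2 ^ (y * (k - 2)) ≤ (T 0).size := by
    intro y
    induction y with
    | zero => intro _; simp [BT.mx]
    | succ y ih =>
      intro hy
      obtain ⟨i1, i2⟩ := ih (by omega)
      obtain ⟨_, t₁, t₂, h1, h2, h3⟩ := hst y (by omega)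
      obtain ⟨s1, s2⟩ := BT.step_spec k (by omega) (y * (k + 1)) (T y) t₁ t₂ (T (y + 1))
        (hbst y (by omega)) (hch y (by omega)).1 h1 h2 h3
      refine ⟨by omega, ?_⟩
      rw [show (y + 1) * (k + 1) = y * (k + 1) + (k + 1) by ring,
        show (y + 1) * (k - 2) = y * (k - 2) + (k - 2) by ring, pow_add]
      have e : 2 ^ k = 4 * 2 ^ (k - 2) := by
        conv_lhs => rw [show k = 2 + (k - 2) by omega, pow_add]
        norm_num
      rw [e] at s2
      have s3 : BT.mx (y * (k + 1) + (k + 1)) (T (y + 1)) * 2 ^ (k - 2) ≤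
          BT.mx (y * (k + 1)) (T y) := by nlinarith
      calc _ = BT.mx (y * (k + 1) + (k + 1)) (T (y + 1)) * 2 ^ (k - 2) * 2 ^ (y * (k - 2)) := by
            ring
        _ ≤ _ := (Nat.mul_le_mul_right _ s3).trans i2
  intro y hy
  obtain ⟨m1, m2⟩ := main y hy
  constructor
  · rw [BT.height_eq _ (hbst y hy), BT.height_eq _ (hbst 0 (by omega))]
    obtain ⟨x, hx⟩ := hne 0 (by omega)
    have := BT.sig_lt_ht' _ (hbst 0 (by omega)) x hx
    omega
  · intro x hx hs
    have h := BT.subtreeAt_size_le _ (hbst y hy) x hx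
    rw [hs] at h
    have h' := (Nat.mul_le_mul_right (2 ^ (y * (k - 2))) h).trans m2
    rw [zpow_neg, zpow_natCast, ← div_eq_mul_inv, le_div_iff₀ (by positivity)]
    exact_mod_cast h'
end

section
/- There exists a constant C > 0 such that for every integer k ≥ 5, every 1-chunking sequence S_1,…,S_h of non-empty finite subsets of ℝ, every k-bulk tree sequence T_1,…,T_h based on S_1,…,S_h, and every y ∈ {1,…,h}: h(T_y) ≤ log₂|T_y| + C·(k + log₂|T_y| / k). -/
attribute [local instance] Classical.propDecidable

/-- `T 1, …, T h` is a `k`-bulk tree sequence: `T 1` is a perfectly balanced binary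
search tree, and there are indices `1 = h_1 < h_2 < … < h_ℓ = h` such that each block
`T (h_j), …, T (h_{j+1})` is a one-phase `k`-bulk tree sequence, all of them complete
(`h(T_{h_{j+1}}) ≤ (h_{j+1} − h_j)·(k+1)`) except possibly the last one. -/
def KBulkSeq (k h : ℕ) (T : ℕ → BT) : Prop :=
  BT.IsPerfBalBST (T 1).nodes (T 1) ∧
  ∃ ℓ : ℕ, 1 ≤ ℓ ∧ ∃ hs : ℕ → ℕ,
    hs 1 = 1 ∧ hs ℓ = h ∧
    (∀ j, 1 ≤ j → j < ℓ → hs j < hs (j + 1)) ∧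
    (∀ j, 1 ≤ j → j < ℓ →
      OnePhaseSeq k (hs (j + 1) - hs j) (fun i => T (hs j + i)) ∧
      (j < ℓ - 1 → (T (hs (j + 1))).height ≤ (hs (j + 1) - hs j) * (k + 1)))

namespace BTP
open BT

/-- Number of levels of a tree. -/
def ht : BT → ℕ
  | .leaf => 0
  | .node l _ r => max (ht l) (ht r) + 1

/-- Maximum size of a subtree rooted at depth `d`. -/
def ms : ℕ → BT → ℕ
  | 0, t => t.size
  | _ + 1, .leaf => 0
  | d + 1, .node l _ r => max (ms d l) (ms d r)

theorem mem_inorder (t : BT) (x : ℝ) : x ∈ t.inorder ↔ x ∈ t.nodes := by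
  induction t with
  | leaf => simp [inorder, nodes]
  | node l v r ihl ihr =>
    simp only [inorder, nodes, List.mem_append, List.mem_cons, Finset.mem_insert,
      Finset.mem_union, ihl, ihr]
    tauto

theorem length_inorder (t : BT) : t.inorder.length = t.size := by
  induction t with
  | leaf => simp [inorder, size]
  | node l v r ihl ihr => simp [inorder, size, ihl, ihr]; omega

theorem bst_iff (t : BT) : t.isBST ↔ t.inorder.Pairwise (· < ·) := by
  induction t with
  | leaf => simp [inorder, isBST]
  | node l v r ihl ihr =>
    simp only [inorder, isBST, List.pairwise_append, List.pairwise_cons, ihl, ihr, ← mem_inorder,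
      List.mem_cons]
    constructor
    · rintro ⟨h1, h2, h3, h4⟩
      refine ⟨h3, ⟨h2, h4⟩, ?_⟩
      rintro a ha b (rfl | hb)
      · exact h1 a ha
      · exact (h1 a ha).trans (h2 b hb)
    · rintro ⟨h3, ⟨h2, h4⟩, h5⟩
      exact ⟨fun x hx => h5 x hx v (Or.inl rfl), h2, h3, h4⟩

theorem sorted_ext {l₁ l₂ : List ℝ} (h1 : l₁.Pairwise (· < ·)) (h2 : l₂.Pairwise (· < ·))
    (h : ∀ x, x ∈ l₁ ↔ x ∈ l₂) : l₁ = l₂ := by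
  have n1 : l₁.Nodup := h1.imp (fun h => ne_of_lt h)
  have n2 : l₂.Nodup := h2.imp (fun h => ne_of_lt h)
  have hp : l₁.Perm l₂ := (List.perm_ext_iff_of_nodup n1 n2).2 h
  exact hp.eq_of_pairwise (fun a b _ _ hab hba => absurd hab (lt_asymm hba)) h1 h2

theorem inorder_eq_of_nodes {s t : BT} (hs : s.isBST) (ht : t.isBST) (h : s.nodes = t.nodes) :
    s.inorder = t.inorder :=
  sorted_ext ((bst_iff s).1 hs) ((bst_iff t).1 ht) (fun x => by rw [mem_inorder, mem_inorder, h])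

theorem nodes_of_inorder {s t : BT} (h : s.inorder = t.inorder) : s.nodes = t.nodes := by
  ext x; rw [← mem_inorder, ← mem_inorder, h]

theorem bst_of_inorder {s t : BT} (h : s.inorder = t.inorder) (ht : t.isBST) : s.isBST := by
  rw [bst_iff, h, ← bst_iff]; exact ht

theorem card_nodes {t : BT} (h : t.isBST) : t.nodes.card = t.size := by
  have n1 : t.inorder.Nodup := ((bst_iff t).1 h).imp (fun h => ne_of_lt h)
  rw [← length_inorder, ← List.toFinset_card_of_nodup n1]
  congr 1
  ext x; simp [mem_inorder]

theorem size_lt (t : BT) : t.size < 2 ^ ht t := by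
  induction t with
  | leaf => simp [size, ht]
  | node l v r ihl ihr =>
    have h1 : 2 ^ ht l ≤ 2 ^ max (ht l) (ht r) := Nat.pow_le_pow_right (by norm_num) (le_max_left _ _)
    have h2 : 2 ^ ht r ≤ 2 ^ max (ht l) (ht r) := Nat.pow_le_pow_right (by norm_num) (le_max_right _ _)
    simp only [size, ht, pow_succ]
    omega

theorem ms_le_size (d : ℕ) (t : BT) : ms d t ≤ t.size := by
  induction d generalizing t with
  | zero => simp [ms]
  | succ d ih =>
    cases t with
    | leaf => simp [ms]
    | node l v r =>
      have := ih l
      have := ih r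
      simp only [ms, size]; omega

theorem ms_eq_zero {d : ℕ} {t : BT} (h : ht t ≤ d) : ms d t = 0 := by
  induction d generalizing t with
  | zero =>
    cases t with
    | leaf => simp [ms, size]
    | node l v r => simp [ht] at h
  | succ d ih =>
    cases t with
    | leaf => simp [ms]
    | node l v r =>
      simp only [ht] at h
      simp only [ms]
      rw [ih (t := l) (by omega), ih (t := r) (by omega)]; simp

theorem ms_pos {d : ℕ} {t : BT} (h : d < ht t) : 0 < ms d t := by
  induction d generalizing t with
  | zero =>
    cases t with
    | leaf => simp [ht] at h
    | node l v r => simp [ms, size]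
  | succ d ih =>
    cases t with
    | leaf => simp [ht] at h
    | node l v r =>
      simp only [ht] at h
      simp only [ms]
      rcases le_total (ht l) (ht r) with h' | h'
      · have := ih (t := r) (by omega); omega
      · have := ih (t := l) (by omega); omega

/-- For a search tree, `height` is the number of levels minus one. -/
theorem height_eq {t : BT} (h : t.isBST) : t.height = ht t - 1 := by
  induction t with
  | leaf => simp [height, nodes, ht]
  | node l v r ihl ihr =>
    obtain ⟨hl, hr, bl, br⟩ := h
    have ihl := ihl bl
    have ihr := ihr br
    have sl : ∀ x ∈ nodes l, (sig (.node l v r) x).length = (sig l x).length + 1 := by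
      intro x hx
      simp [sig, hl x hx]
    have sr : ∀ x ∈ nodes r, (sig (.node l v r) x).length = (sig r x).length + 1 := by
      intro x hx
      simp [sig, hr x hx, not_lt.2 (hr x hx).le]
    have hz : ∀ s : BT, ht s ≠ 0 → s.nodes.Nonempty := by
      intro s hs
      cases s with
      | leaf => simp [ht] at hs
      | node a b c => exact ⟨b, by simp [nodes]⟩
    simp only [ht, Nat.add_sub_cancel]
    apply le_antisymm
    · apply Finset.sup_le
      intro x hx
      simp only [nodes, Finset.mem_insert, Finset.mem_union] at hx
      have key : ∀ s : BT, x ∈ s.nodes → s.height = ht s - 1 → (sig s x).length + 1 ≤ ht s := by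
        intro s hx hs
        have h1 : (sig s x).length ≤ s.height :=
          Finset.le_sup (f := fun x => (sig s x).length) hx
        cases s with
        | leaf => simp [nodes] at hx
        | node a b c => simp only [ht] at hs ⊢; omega
      rcases hx with rfl | hx | hx
      · simp [sig]
      · rw [sl x hx]; exact (key l hx ihl).trans (le_max_left _ _)
      · rw [sr x hx]; exact (key r hx ihr).trans (le_max_right _ _)
    · have key : ∀ s : BT, s.height = ht s - 1 →
          (∀ x ∈ s.nodes, x ∈ (BT.node l v r).nodes ∧
            (sig (.node l v r) x).length = (sig s x).length + 1) →
          ht s ≤ (BT.node l v r).height := by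
        intro s hs hn
        by_cases h0 : ht s = 0
        · omega
        obtain ⟨x, hx, hxe⟩ := Finset.exists_mem_eq_sup _ (hz s h0) (fun x => (sig s x).length)
        have h1 : s.height = (sig s x).length := hxe
        obtain ⟨h2, h3⟩ := hn x hx
        have h4 : (sig (.node l v r) x).length ≤ (BT.node l v r).height :=
          Finset.le_sup (f := fun x => (sig (.node l v r) x).length) h2
        omega
      refine max_le (key l ihl fun x hx => ⟨?_, sl x hx⟩) (key r ihr fun x hx => ⟨?_, sr x hx⟩)
      · simp [nodes, hx]
      · simp [nodes, hx]

/-! ### Deletion -/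

/-- `Sub s t`: the shape of `s` is contained in the shape of `t`. -/
def Sub : BT → BT → Prop
  | .leaf, _ => True
  | .node _ _ _, .leaf => False
  | .node l _ r, .node l' _ r' => Sub l l' ∧ Sub r r'

theorem Sub.refl (t : BT) : Sub t t := by
  induction t with
  | leaf => trivial
  | node l v r ihl ihr => exact ⟨ihl, ihr⟩

theorem Sub.size {s t : BT} (h : Sub s t) : s.size ≤ t.size := by
  induction s generalizing t with
  | leaf => simp [BT.size]
  | node l v r ihl ihr =>
    cases t with
    | leaf => exact h.elim
    | node l' v' r' =>
      have := ihl h.1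
      have := ihr h.2
      simp only [BT.size]; omega

theorem Sub.ht {s t : BT} (h : Sub s t) : ht s ≤ ht t := by
  induction s generalizing t with
  | leaf => simp [BTP.ht]
  | node l v r ihl ihr =>
    cases t with
    | leaf => exact h.elim
    | node l' v' r' =>
      have := ihl h.1
      have := ihr h.2
      simp only [BTP.ht]; omega

theorem Sub.ms {s t : BT} (h : Sub s t) (d : ℕ) : ms d s ≤ ms d t := by
  induction d generalizing s t with
  | zero => exact h.size
  | succ d ih =>
    cases s with
    | leaf => simp [BTP.ms]
    | node l v r =>
      cases t with
      | leaf => exact h.elim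
      | node l' v' r' =>
        have := ih h.1
        have := ih h.2
        simp only [BTP.ms]; omega

theorem sub_extractMax (t : BT) : ∀ m t', extractMax t = some (m, t') → Sub t' t := by
  induction t with
  | leaf => simp [extractMax]
  | node l v r ihl ihr =>
    intro m t' h
    cases r with
    | leaf =>
      rw [extractMax] at h
      split at h
      · simp only [Option.some.injEq, Prod.mk.injEq] at h
        rw [← h.2]; trivial
      · rename_i m' l' he
        simp only [Option.some.injEq, Prod.mk.injEq] at h
        rw [← h.2]; exact ⟨ihl _ _ he, trivial⟩
    | node a b c =>
      rw [extractMax] at h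
      split at h
      · rename_i he
        exfalso
        revert he
        cases c <;> rw [extractMax] <;> split <;> simp
      · rename_i m' l' he
        simp only [Option.some.injEq, Prod.mk.injEq] at h
        rw [← h.2]; exact ⟨Sub.refl _, ihr _ _ he⟩

theorem sub_extractMin (t : BT) : ∀ m t', extractMin t = some (m, t') → Sub t' t := by
  induction t with
  | leaf => simp [extractMin]
  | node l v r ihl ihr =>
    intro m t' h
    cases l with
    | leaf =>
      rw [extractMin] at h
      split at h
      · simp only [Option.some.injEq, Prod.mk.injEq] at h
        rw [← h.2]; trivial
      · rename_i m' l' he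
        simp only [Option.some.injEq, Prod.mk.injEq] at h
        rw [← h.2]; exact ⟨trivial, ihr _ _ he⟩
    | node a b c =>
      rw [extractMin] at h
      split at h
      · rename_i he
        exfalso
        revert he
        cases a <;> rw [extractMin] <;> split <;> simp
      · rename_i m' l' he
        simp only [Option.some.injEq, Prod.mk.injEq] at h
        rw [← h.2]; exact ⟨ihl _ _ he, Sub.refl _⟩

theorem sub_delete (t : BT) (x : ℝ) : Sub (delete t x) t := by
  induction t with
  | leaf => trivial
  | node l v r ihl ihr =>
    rw [delete]
    split_ifs
    · exact ⟨ihl, Sub.refl _⟩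
    · exact ⟨Sub.refl _, ihr⟩
    · split
      · rename_i he
        exact ⟨sub_extractMax _ _ _ he, Sub.refl _⟩
      · split
        · rename_i he
          exact ⟨trivial, sub_extractMin _ _ _ he⟩
        · trivial

theorem foldl_delete (L : List ℝ) (t : BT) :
    ht (L.foldl BT.delete t) ≤ ht t ∧ ∀ d, ms d (L.foldl BT.delete t) ≤ ms d t := by
  induction L generalizing t with
  | nil => simp
  | cons x L ih =>
    obtain ⟨h1, h2⟩ := ih (delete t x)
    exact ⟨h1.trans (sub_delete t x).ht, fun d => (h2 d).trans ((sub_delete t x).ms d)⟩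

/-! ### Insertion -/

theorem foldl_ins_node (L : List ℝ) (l r : BT) (v : ℝ) (hv : v ∉ L) :
    L.foldl BT.ins (.node l v r) =
      .node ((L.filter (fun x => x < v)).foldl BT.ins l) v
        ((L.filter (fun x => v < x)).foldl BT.ins r) := by
  induction L generalizing l r with
  | nil => simp
  | cons x L ih =>
    simp only [List.mem_cons, not_or] at hv
    rcases lt_or_gt_of_ne hv.1 with h | h
    · simp [BT.ins, h, not_lt.2 h.le, ih _ _ hv.2]
    · simp [BT.ins, h, not_lt.2 h.le, ih _ _ hv.2]

theorem foldl_ins (t : BT) (hb : t.isBST) (L : List ℝ) (hn : L.Nodup)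
    (hd : ∀ x ∈ L, x ∉ t.nodes)
    (hg : ∀ a ∈ L, ∀ b ∈ L, a < b → ∃ x ∈ t.nodes, a ≤ x ∧ x ≤ b) :
    ht (L.foldl BT.ins t) ≤ ht t + 1 ∧ (L.foldl BT.ins t).size ≤ 2 * t.size + 1 ∧
      ∀ d, ms d (L.foldl BT.ins t) ≤ 2 * ms d t + 1 := by
  induction t generalizing L with
  | leaf =>
    cases L with
    | nil =>
      simp only [List.foldl_nil]
      exact ⟨by omega, by omega, fun d => by omega⟩
    | cons a L =>
      cases L with
      | nil =>
        refine ⟨?_, ?_, ?_⟩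
        · simp [BT.ins, ht]
        · simp [BT.ins, size]
        · intro d
          refine (ms_le_size _ _).trans ?_
          simp [BT.ins, size]
      | cons b L =>
        exfalso
        simp only [nodes, Finset.notMem_empty, false_and, exists_false] at hg
        have hab : a ≠ b := by
          intro h; simp [h] at hn
        rcases lt_or_gt_of_ne hab with h | h
        · exact hg a (by simp) b (by simp) h
        · exact hg b (by simp) a (by simp) h
  | node l v r ihl ihr =>
    obtain ⟨hl, hr, bl, br⟩ := hb
    have hv : v ∉ L := fun h => hd v h (by simp [nodes])
    rw [foldl_ins_node L l r v hv]
    obtain ⟨a1, a2, a3⟩ := ihl bl (L.filter (fun x => x < v)) (hn.filter _)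
      (by
        intro x hx h
        exact hd x (List.mem_of_mem_filter hx) (by simp [nodes, h]))
      (by
        intro a ha b hb hab
        simp only [List.mem_filter, decide_eq_true_eq] at ha hb
        obtain ⟨x, hx, h1, h2⟩ := hg a ha.1 b hb.1 hab
        refine ⟨x, ?_, h1, h2⟩
        simp only [nodes, Finset.mem_insert, Finset.mem_union] at hx
        rcases hx with rfl | hx | hx
        · linarith [hb.2]
        · exact hx
        · linarith [hr x hx, hb.2])
    obtain ⟨b1, b2, b3⟩ := ihr br (L.filter (fun x => v < x)) (hn.filter _)
      (by
        intro x hx h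
        exact hd x (List.mem_of_mem_filter hx) (by simp [nodes, h]))
      (by
        intro a ha b hb hab
        simp only [List.mem_filter, decide_eq_true_eq] at ha hb
        obtain ⟨x, hx, h1, h2⟩ := hg a ha.1 b hb.1 hab
        refine ⟨x, ?_, h1, h2⟩
        simp only [nodes, Finset.mem_insert, Finset.mem_union] at hx
        rcases hx with rfl | hx | hx
        · linarith [ha.2]
        · linarith [hl x hx, ha.2]
        · exact hx)
    refine ⟨?_, ?_, ?_⟩
    · simp only [ht]; omega
    · simp only [size]; omega
    · intro d
      cases d with
      | zero => simp only [ms, size]; omega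
      | succ d =>
        have := a3 d
        have := b3 d
        simp only [ms]; omega

theorem chunks_pair {X Y : Finset ℝ} (h : Chunks 1 X Y) {a b : ℝ} (ha : a ∈ Y) (hb : b ∈ Y)
    (hab : a < b) : ∃ x ∈ X, a ≤ x ∧ x ≤ b := by
  obtain ⟨x, hx, ⟨s, hs, h1⟩, ⟨s', hs', h2⟩⟩ := h {a, b}
    (by intro z hz; simp only [Finset.mem_insert, Finset.mem_singleton] at hz
        rcases hz with rfl | rfl <;> assumption)
    (Finset.card_pair hab.ne)
  simp only [Finset.mem_insert, Finset.mem_singleton] at hs hs'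
  refine ⟨x, hx, ?_, ?_⟩
  · rcases hs with rfl | rfl <;> linarith
  · rcases hs' with rfl | rfl <;> linarith

theorem chunks_card {X Y : Finset ℝ} (h : Chunks 1 X Y) : Y.card ≤ 2 * X.card + 1 := by
  have key : (Y \ X).card ≤ (Finset.range (X.card + 1)).card := by
    apply Finset.card_le_card_of_injOn (fun y => (X.filter (fun x => x < y)).card)
    · intro y _
      simp only [Finset.coe_range, Set.mem_Iio]
      exact Nat.lt_succ_of_le (Finset.card_le_card (Finset.filter_subset _ _))
    · have hlt : ∀ a ∈ Y \ X, ∀ b ∈ Y \ X, a < b →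
          (X.filter (fun x => x < a)).card < (X.filter (fun x => x < b)).card := by
        intro a ha b hb hab
        rw [Finset.mem_sdiff] at ha hb
        obtain ⟨x, hx, h1, h2⟩ := chunks_pair h ha.1 hb.1 hab
        have h3 : x ≠ b := fun h => hb.2 (h ▸ hx)
        apply Finset.card_lt_card
        rw [Finset.ssubset_iff_of_subset]
        · exact ⟨x, by simp [hx, lt_of_le_of_ne h2 h3], by simp [h1]⟩
        · intro z hz
          simp only [Finset.mem_filter] at hz ⊢
          exact ⟨hz.1, hz.2.trans hab⟩
      intro a ha b hb hab
      by_contra hne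
      rcases lt_or_gt_of_ne hne with h' | h'
      · exact (hlt a ha b hb h').ne hab
      · exact (hlt b hb a ha h').ne hab.symm
  rw [Finset.card_range] at key
  have h2 : Y.card ≤ (Y \ X).card + X.card := by
    have := Finset.card_le_card_sdiff_add_card (s := Y) (t := X)
    omega
  omega

/-! ### Balancing -/

/-- `Dec w es ts`: the list `w` is the interleaving of the in-order lists of the trees `ts`
with the separators `es`. -/
inductive Dec : List ℝ → List ℝ → List BT → Prop
  | single (t : BT) : Dec t.inorder [] [t]
  | cons (t : BT) (e : ℝ) (w es : List ℝ) (ts : List BT) (h : Dec w es ts) :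
      Dec (t.inorder ++ e :: w) (e :: es) (t :: ts)

theorem Dec.append {w es ts w' es' ts'} (e : ℝ) (h : Dec w es ts) (h' : Dec w' es' ts') :
    Dec (w ++ e :: w') (es ++ e :: es') (ts ++ ts') := by
  induction h with
  | single t => exact Dec.cons t e _ _ _ h'
  | cons t f w es ts h ih =>
    have := Dec.cons t f _ _ _ ih
    simpa using this

theorem Dec.unappend {w : List ℝ} {ts : List BT} (es es' : List ℝ) (e : ℝ)
    (h : Dec w (es ++ e :: es') ts) :
    ∃ w₁ w₂ ts₁ ts₂, w = w₁ ++ e :: w₂ ∧ ts = ts₁ ++ ts₂ ∧ Dec w₁ es ts₁ ∧ Dec w₂ es' ts₂ := by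
  induction es generalizing w ts with
  | nil =>
    cases h with
    | cons t e w es ts h =>
      exact ⟨_, w, [t], ts, rfl, rfl, Dec.single t, h⟩
  | cons f es ih =>
    cases h with
    | cons t e w es ts h =>
      obtain ⟨w₁, w₂, ts₁, ts₂, rfl, rfl, h1, h2⟩ := ih h
      exact ⟨_, w₂, _, ts₂, by simp, by simp, Dec.cons t f _ _ _ h1, h2⟩

theorem Dec.glue (t0 : BT) {w : List ℝ} {ts : List BT} (h : Dec w t0.inorder ts)
    (rest : List BT) :
    (glue t0 (ts ++ rest)).1.inorder = w ∧ (glue t0 (ts ++ rest)).2 = rest := by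
  induction t0 generalizing w ts rest with
  | leaf =>
    rw [inorder] at h
    cases h with
    | single t => simp [BT.glue]
  | node l v r ihl ihr =>
    rw [inorder] at h
    obtain ⟨w₁, w₂, ts₁, ts₂, rfl, rfl, h1, h2⟩ := h.unappend
    obtain ⟨a1, a2⟩ := ihl h1 (ts₂ ++ rest)
    obtain ⟨b1, b2⟩ := ihr h2 rest
    rw [← List.append_assoc] at a1 a2
    simp only [BT.glue, inorder, a1, a2, b1, b2, and_self]

/-- Every part of a decomposition is an infix of the list. -/
theorem Dec.factor {w es : List ℝ} {ts : List BT} (h : Dec w es ts) :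
    ∀ p ∈ ts, ∃ u v, w = u ++ p.inorder ++ v := by
  induction h with
  | single t =>
    intro p hp
    simp only [List.mem_singleton] at hp
    subst hp
    exact ⟨[], [], by simp⟩
  | cons t e w es ts h ih =>
    intro p hp
    simp only [List.mem_cons] at hp
    rcases hp with rfl | hp
    · exact ⟨[], e :: w, by simp⟩
    · obtain ⟨u, v, rfl⟩ := ih p hp
      exact ⟨t.inorder ++ e :: u, v, by simp⟩

theorem Dec.mem {w es : List ℝ} {ts : List BT} (h : Dec w es ts) : ∀ x ∈ es, x ∈ w := by
  induction h with
  | single t => simp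
  | cons t e w es ts h ih =>
    intro x hx
    simp only [List.mem_cons] at hx
    rcases hx with rfl | hx
    · simp
    · simp [ih x hx]

theorem Dec.avoid {w es : List ℝ} {ts : List BT} (h : Dec w es ts) (hw : w.Nodup) :
    ∀ p ∈ ts, ∀ x ∈ p.inorder, x ∉ es := by
  induction h with
  | single t => simp
  | cons t e w es ts h ih =>
    intro p hp x hx hxe
    rw [List.nodup_append] at hw
    obtain ⟨h1, h2, h3⟩ := hw
    rw [List.nodup_cons] at h2
    simp only [List.mem_cons] at hp hxe
    rcases hp with rfl | hp
    · rcases hxe with rfl | hxe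
      · exact h3 x hx x (by simp) rfl
      · exact h3 x hx x (by simp [h.mem x hxe]) rfl
    · rcases hxe with rfl | hxe
      · obtain ⟨u, v, rfl⟩ := h.factor p hp
        exact h2.1 (by simp [hx])
      · exact ih h2.2 p hp x hx hxe

theorem split_inorder (t : BT) (hb : t.isBST) (x : ℝ) (hx : x ∈ t.nodes) :
    t.inorder = (split t x).1.inorder ++ x :: (split t x).2.inorder := by
  induction t with
  | leaf => simp [nodes] at hx
  | node l v r ihl ihr =>
    obtain ⟨hl, hr, bl, br⟩ := hb
    simp only [nodes, Finset.mem_insert, Finset.mem_union] at hx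
    rw [split]
    split_ifs with h1 h2
    · have hx' : x ∈ l.nodes := by
        rcases hx with rfl | hx | hx
        · exact absurd h1 (lt_irrefl _)
        · exact hx
        · exact absurd (hr x hx) (lt_asymm h1)
      simp only [inorder]
      rw [ihl bl hx']
      simp
    · have hx' : x ∈ r.nodes := by
        rcases hx with rfl | hx | hx
        · exact absurd h2 (lt_irrefl _)
        · exact absurd (hl x hx) (lt_asymm h2)
        · exact hx
      simp only [inorder]
      rw [ihr br hx']
      simp
    · have : x = v := le_antisymm (not_lt.1 h2) (not_lt.1 h1)
      subst this
      simp [inorder]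

theorem split_ht (t : BT) (x : ℝ) : ht (split t x).1 ≤ ht t ∧ ht (split t x).2 ≤ ht t := by
  induction t with
  | leaf => simp [split]
  | node l v r ihl ihr =>
    rw [split]
    split_ifs <;> simp only [ht] <;> omega

theorem multiSplit_ht (n : ℕ) : ∀ (t : BT) (xs : List ℝ), xs.length ≤ n →
    ∀ p ∈ multiSplit t xs, ht p ≤ ht t := by
  induction n with
  | zero =>
    intro t xs hx p hp
    have : xs = [] := List.eq_nil_of_length_eq_zero (by omega)
    subst this
    rw [multiSplit] at hp
    simp only [List.mem_singleton] at hp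
    rw [hp]
  | succ n ih =>
    intro t xs hx p hp
    cases xs with
    | nil =>
      rw [multiSplit] at hp
      simp only [List.mem_singleton] at hp
      rw [hp]
    | cons x₀ xs' =>
      rw [multiSplit, List.mem_append] at hp
      rcases hp with hp | hp
      · refine (ih _ _ ?_ p hp).trans (split_ht t _).1
        simp only [List.length_take, List.length_cons] at hx ⊢; omega
      · refine (ih _ _ ?_ p hp).trans (split_ht t _).2
        simp only [List.length_drop, List.length_cons] at hx ⊢; omega

theorem multiSplit_dec (n : ℕ) : ∀ (t : BT) (xs : List ℝ), xs.length ≤ n → t.isBST →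
    xs.Pairwise (· < ·) → (∀ x ∈ xs, x ∈ t.nodes) → Dec t.inorder xs (multiSplit t xs) := by
  induction n with
  | zero =>
    intro t xs hx _ _ _
    have : xs = [] := List.eq_nil_of_length_eq_zero (by omega)
    subst this
    rw [multiSplit]
    exact Dec.single t
  | succ n ih =>
    intro t xs hx hb hs hm
    cases xs with
    | nil =>
      rw [multiSplit]
      exact Dec.single t
    | cons x₀ xs' =>
      rw [multiSplit]
      generalize hxs : x₀ :: xs' = xs at *
      have hpos : 1 ≤ xs.length := by rw [← hxs]; simp
      obtain ⟨i, hi⟩ : ∃ i, i = (xs.length + 1) / 2 - 1 := ⟨_, rfl⟩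
      have hi' : (xs.length + 1) / 2 = i + 1 := by omega
      have hil : i < xs.length := by omega
      rw [hi', Nat.add_sub_cancel]
      have hget : xs.getD i 0 = xs[i] := by simp [List.getD, hil]
      rw [hget]
      have hdec : xs = xs.take i ++ xs[i] :: xs.drop (i + 1) := by simp
      generalize xs[i] = c at *
      generalize hA : xs.take i = A at *
      generalize hB : xs.drop (i + 1) = B at *
      have hAl : A.length ≤ n := by rw [← hA, List.length_take]; omega
      have hBl : B.length ≤ n := by rw [← hB, List.length_drop]; omega
      subst hdec
      have hsp := split_inorder t hb c (hm c (by simp))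
      have hbt := (bst_iff t).1 hb
      rw [hsp] at hbt
      rw [List.pairwise_append, List.pairwise_cons] at hbt hs
      obtain ⟨p1, ⟨p2, p3⟩, p4⟩ := hbt
      obtain ⟨q1, ⟨q2, q3⟩, q4⟩ := hs
      rw [hsp]
      apply Dec.append
      · refine ih _ _ hAl ((bst_iff _).2 p1) q1 ?_
        intro x hx
        have h1 : x < c := q4 x hx c (by simp)
        have h2 := hm x (by simp [hx])
        rw [← mem_inorder, hsp, List.mem_append, List.mem_cons] at h2
        rw [← mem_inorder]
        rcases h2 with h2 | rfl | h2
        · exact h2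
        · exact absurd h1 (lt_irrefl _)
        · exact absurd (p2 x h2) (lt_asymm h1)
      · refine ih _ _ hBl ((bst_iff _).2 p3) q3 ?_
        intro x hx
        have h1 : c < x := q2 x hx
        have h2 := hm x (by simp [hx])
        rw [← mem_inorder, hsp, List.mem_append, List.mem_cons] at h2
        rw [← mem_inorder]
        rcases h2 with h2 | rfl | h2
        · exact absurd (p4 x h2 c (by simp)) (lt_asymm h1)
        · exact absurd h1 (lt_irrefl _)
        · exact h2

/-- The sorted list of nodes that have depth `< k` or satisfy `P`. -/
noncomputable def sel (P : ℝ → Prop) : ℕ → BT → List ℝ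
  | 0, t => t.inorder.filter (fun x => P x)
  | _ + 1, .leaf => []
  | k + 1, .node l v r => sel P k l ++ v :: sel P k r

theorem sel_sublist (P : ℝ → Prop) (k : ℕ) (t : BT) : (sel P k t).Sublist t.inorder := by
  induction k generalizing t with
  | zero => exact List.filter_sublist
  | succ k ih =>
    cases t with
    | leaf => simp [sel, inorder]
    | node l v r =>
      rw [sel, inorder]
      exact (ih l).append ((ih r).cons_cons v)

theorem mem_sel (P : ℝ → Prop) (k : ℕ) (t : BT) (hb : t.isBST) (x : ℝ) :
    x ∈ sel P k t ↔ x ∈ t.nodes ∧ ((sig t x).length < k ∨ P x) := by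
  induction k generalizing t with
  | zero => simp [sel, mem_inorder]
  | succ k ih =>
    cases t with
    | leaf => simp [sel, nodes]
    | node l v r =>
      obtain ⟨hl, hr, bl, br⟩ := hb
      simp only [sel, List.mem_append, List.mem_cons, ih l bl, ih r br, nodes, Finset.mem_insert,
        Finset.mem_union]
      rcases lt_trichotomy x v with h | h | h
      · have h1 : x ∉ r.nodes := fun h' => lt_asymm h (hr x h')
        simp [sig, h, h.ne, h1]
      · simp [sig, h]
      · have h1 : x ∉ l.nodes := fun h' => lt_asymm h (hl x h')
        simp [sig, h, h.ne', h1, not_lt.2 h.le]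

theorem sel_false_length (k : ℕ) (t : BT) : (sel (fun _ => False) k t).length + 1 ≤ 2 ^ k := by
  induction k generalizing t with
  | zero => simp [sel]
  | succ k ih =>
    cases t with
    | leaf => simp [sel, Nat.one_le_two_pow]
    | node l v r =>
      have := ih l
      have := ih r
      simp only [sel, List.length_append, List.length_cons, pow_succ]; omega

theorem sel_dec (P : ℝ → Prop) (k : ℕ) (t : BT) (hb : t.isBST) :
    Dec t.inorder (sel P k t)
      ((slots k t).flatMap fun ti => multiSplit ti ((inorder ti).filter fun x => P x)) := by
  induction k generalizing t with
  | zero =>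
    simp only [slots, sel, List.flatMap_cons, List.flatMap_nil, List.append_nil]
    refine multiSplit_dec _ t _ le_rfl hb ?_ ?_
    · exact ((bst_iff t).1 hb).sublist List.filter_sublist
    · intro x hx
      rw [← mem_inorder]
      exact List.mem_of_mem_filter hx
  | succ k ih =>
    cases t with
    | leaf =>
      simp only [slots, sel, List.flatMap_cons, List.flatMap_nil, List.append_nil, inorder,
        List.filter_nil]
      rw [multiSplit]
      exact Dec.single .leaf
    | node l v r =>
      obtain ⟨hl, hr, bl, br⟩ := hb
      simp only [slots, sel, List.flatMap_append, inorder]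
      exact (ih l bl).append v (ih r br)

theorem slots_ht (k : ℕ) (t : BT) : ∀ p ∈ slots k t, ht p ≤ ht t - k := by
  induction k generalizing t with
  | zero => simp [slots]
  | succ k ih =>
    intro p hp
    cases t with
    | leaf =>
      simp only [slots, List.mem_singleton] at hp
      simp [hp, ht]
    | node l v r =>
      simp only [slots, List.mem_append] at hp
      simp only [ht]
      rcases hp with hp | hp
      · have := ih l p hp; omega
      · have := ih r p hp; omega

theorem balParts_ht (t : BT) (k : ℕ) : ∀ p ∈ balParts t k, ht p ≤ ht t - k := by
  intro p hp
  rw [balParts, List.mem_flatMap] at hp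
  obtain ⟨ti, h1, h2⟩ := hp
  exact (multiSplit_ht _ _ _ le_rfl p h2).trans (slots_ht k t ti h1)

theorem glue_bounds (H M : ℕ) (t0 : BT) (ts : List BT)
    (h1 : ∀ p ∈ ts, ht p ≤ H) (h2 : ∀ p ∈ ts, p.size ≤ M) :
    ht (glue t0 ts).1 ≤ ht t0 + H ∧ (∀ D, ht t0 ≤ D → ms D (glue t0 ts).1 ≤ M) ∧
      ∀ p ∈ (glue t0 ts).2, p ∈ ts := by
  induction t0 generalizing ts with
  | leaf =>
    cases ts with
    | nil =>
      simp only [glue, List.headD_nil, ht]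
      exact ⟨by omega, fun D _ => (ms_le_size _ _).trans (by simp [size]), by simp⟩
    | cons p ts =>
      simp only [glue, List.headD_cons, ht, List.tail_cons]
      refine ⟨by simpa using h1 p (by simp), fun D _ => (ms_le_size _ _).trans (h2 p (by simp)), ?_⟩
      intro q hq; simp [hq]
  | node l v r ihl ihr =>
    obtain ⟨a1, a2, a3⟩ := ihl ts h1 h2
    obtain ⟨b1, b2, b3⟩ := ihr (glue l ts).2 (fun p hp => h1 p (a3 p hp))
      (fun p hp => h2 p (a3 p hp))
    simp only [glue, ht]
    refine ⟨by omega, ?_, fun p hp => a3 p (b3 p hp)⟩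
    intro D hD
    cases D with
    | zero => omega
    | succ D =>
      have := a2 D (by omega)
      have := b2 D (by omega)
      simp only [ms]; omega

theorem rank_arith (n K i len : ℕ) (hK : 2 ≤ K) (hn : i + len ≤ n) (hlen : n < len * K) :
    ∃ j, j < K - 1 ∧ i ≤ (j + 1) * n / K ∧ (j + 1) * n / K < i + len := by
  have hK0 : 0 < K := by omega
  rcases Nat.eq_zero_or_pos i with rfl | hi
  · refine ⟨0, by omega, Nat.zero_le _, ?_⟩
    rw [Nat.div_lt_iff_lt_mul hK0]
    simpa using hlen
  · have hn0 : 0 < n := by omega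
    -- `j + 1` is the ceiling of `i K / n`
    obtain ⟨j, hj⟩ : ∃ j, j = (i * K - 1) / n := ⟨_, rfl⟩
    have hiK : 1 ≤ i * K := Nat.mul_pos hi hK0
    have e1 : j * n ≤ i * K - 1 := by rw [hj]; exact Nat.div_mul_le_self _ _
    have e2 : i * K - 1 < (j + 1) * n := by
      rw [hj]; exact (Nat.div_lt_iff_lt_mul hn0).1 (Nat.lt_succ_self _)
    have e3 : (j + 1) * n < (i + len) * K := by
      have : (i + len) * K = i * K + len * K := by ring
      have : (j + 1) * n = j * n + n := by ring
      omega
    refine ⟨j, ?_, ?_, ?_⟩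
    · by_contra hc
      have h1 : K ≤ j + 1 := by omega
      have h2 : K * n ≤ (j + 1) * n := Nat.mul_le_mul_right _ h1
      have h3 : (i + len) * K ≤ n * K := Nat.mul_le_mul_right _ hn
      have : n * K = K * n := by ring
      omega
    · rw [Nat.le_div_iff_mul_le hK0]; omega
    · rw [Nat.div_lt_iff_lt_mul hK0]; exact e3

theorem rank_lt (n K j : ℕ) (hn : 0 < n) (hj : j < K - 1) : (j + 1) * n / K < n := by
  rw [Nat.div_lt_iff_lt_mul (by omega), mul_comm n K]
  exact Nat.mul_lt_mul_of_pos_right (by omega) hn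

theorem rankElems_mem (t : BT) (k : ℕ) (hn : 0 < t.size) : ∀ x ∈ rankElems t k, x ∈ t.nodes := by
  intro x hx
  simp only [rankElems, List.mem_map, List.mem_range] at hx
  obtain ⟨j, hj, rfl⟩ := hx
  have h := rank_lt t.size (2 ^ k) j hn hj
  rw [← length_inorder] at h
  rw [← mem_inorder]
  rw [← length_inorder, List.getD_eq_getElem _ _ h]
  exact List.getElem_mem h

theorem part_size (t : BT) (k : ℕ) (hk : 1 ≤ k) (p : BT) (u v : List ℝ)
    (hw : t.inorder = u ++ p.inorder ++ v) (ha : ∀ x ∈ p.inorder, x ∉ rankElems t k) :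
    p.size * 2 ^ k ≤ t.size := by
  by_contra hc
  push Not at hc
  have hlen : t.size = u.length + p.size + v.length := by
    rw [← length_inorder, hw]; simp [length_inorder]; omega
  have hK : 2 ≤ 2 ^ k := by
    calc 2 = 2 ^ 1 := by norm_num
      _ ≤ 2 ^ k := Nat.pow_le_pow_right (by norm_num) hk
  obtain ⟨j, hj, h1, h2⟩ := rank_arith t.size (2 ^ k) u.length p.size hK (by omega) hc
  generalize hm : (j + 1) * t.size / 2 ^ k = m at *
  have hmem : t.inorder.getD m 0 ∈ rankElems t k := by
    simp only [rankElems, List.mem_map, List.mem_range]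
    exact ⟨j, hj, by rw [hm]⟩
  refine ha _ ?_ hmem
  have hp : m - u.length < p.inorder.length := by rw [length_inorder]; omega
  have : t.inorder.getD m 0 = p.inorder[m - u.length] := by
    rw [hw, List.append_assoc, List.getD_eq_getElem?_getD, List.getElem?_append_right h1,
      List.getElem?_append_left hp, List.getElem?_eq_getElem hp]
    rfl
  rw [this]
  exact List.getElem_mem hp

theorem perf_ht {s : Finset ℝ} {t : BT} (h : IsPerfBalBST s t) (D : ℕ) (hD : t.size < 2 ^ D) :
    ht t ≤ D := by
  obtain ⟨h1, h2, h3⟩ := h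
  rw [height_eq h1] at h3
  by_cases h0 : t.size = 0
  · cases t with
    | leaf => simp [ht]
    | node l v r => simp [size] at h0
  · have := Nat.log_lt_of_lt_pow h0 hD
    omega

theorem balance_result {k : ℕ} (hk : 1 ≤ k) {t s : BT} (hb : t.isBST)
    (h : IsBalanceResult k t s) :
    s.inorder = t.inorder ∧ ht s ≤ ht t + 1 ∧ (t.size < 2 ^ k → ht s ≤ k) ∧
      ms (k + 1) s ≤ t.size / 2 ^ k := by
  rw [IsBalanceResult] at h
  split_ifs at h with hsz
  · have hin : s.inorder = t.inorder := inorder_eq_of_nodes h.1 hb h.2.1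
    have hs : s.size = t.size := by rw [← length_inorder, hin, length_inorder]
    have h1 : ht s ≤ ht t := perf_ht h _ (hs ▸ size_lt t)
    have h2 : ht s ≤ k := perf_ht h _ (hs ▸ hsz)
    refine ⟨hin, by omega, fun _ => h2, ?_⟩
    rw [ms_eq_zero (by omega)]; exact Nat.zero_le _
  · obtain ⟨t0, h0, rfl⟩ := h
    have hn : 0 < t.size := lt_of_lt_of_le (Nat.pow_pos (by norm_num)) (not_lt.1 hsz)
    have hdec := sel_dec (fun x => x ∈ rankElems t k) k t hb
    have hsorted := (bst_iff t).1 hb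
    have hE : sel (fun x => x ∈ rankElems t k) k t = t0.inorder := by
      apply sorted_ext (hsorted.sublist (sel_sublist _ _ _)) ((bst_iff t0).1 h0.1)
      intro x
      rw [mem_sel _ _ _ hb, mem_inorder, h0.2.1]
      simp only [shallowNodes, Finset.mem_union, Finset.mem_filter, List.mem_toFinset]
      have := rankElems_mem t k hn x
      tauto
    rw [hE] at hdec
    replace hdec : Dec t.inorder t0.inorder (balParts t k) := by
      convert hdec using 1
      unfold balParts
      congr!
    have hg := (hdec.glue t0 []).1
    rw [List.append_nil] at hg
    have hnd : t.inorder.Nodup := hsorted.imp (fun h => ne_of_lt h)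
    have hparts : ∀ p ∈ balParts t k, p.size ≤ t.size / 2 ^ k := by
      intro p hp
      obtain ⟨u, v, hw⟩ := hdec.factor p hp
      rw [Nat.le_div_iff_mul_le (Nat.pow_pos (by norm_num))]
      refine part_size t k hk p u v hw ?_
      intro x hx hxr
      refine hdec.avoid hnd p hp x hx ?_
      rw [mem_inorder, h0.2.1]
      simp [hxr]
    have ht0 : ht t0 ≤ k + 1 := by
      apply perf_ht h0
      rw [← card_nodes h0.1, h0.2.1]
      have c1 : (shallowNodes t k).card + 1 ≤ 2 ^ k := by
        have : shallowNodes t k = (sel (fun _ => False) k t).toFinset := by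
          ext x
          rw [List.mem_toFinset, mem_sel _ _ _ hb]
          simp [shallowNodes]
        rw [this]
        have h1 := List.toFinset_card_le (sel (fun _ => False) k t)
        have h2 := sel_false_length k t
        omega
      have c2 : (rankElems t k).toFinset.card ≤ 2 ^ k - 1 := by
        refine (List.toFinset_card_le _).trans ?_
        simp [rankElems]
      have c3 := Finset.card_union_le (shallowNodes t k) (rankElems t k).toFinset
      rw [pow_succ]
      omega
    obtain ⟨g1, g2, _⟩ := glue_bounds _ _ t0 _ (balParts_ht t k) hparts
    refine ⟨hg, ?_, fun h => absurd h hsz, g2 _ ht0⟩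
    have h1 : k < ht t := by
      by_contra hc
      have h2 : 2 ^ ht t ≤ 2 ^ k := Nat.pow_le_pow_right (by norm_num) (not_lt.1 hc)
      have := size_lt t
      omega
    omega

theorem bulkBalance {k : ℕ} (hk : 1 ≤ k) (θ : ℕ) {t s : BT} (hb : t.isBST)
    (h : BulkBalanceRel k θ t s) :
    s.inorder = t.inorder ∧ ht s ≤ ht t + 1 ∧ (ms θ t < 2 ^ k → ht s ≤ θ + k) ∧
      ms (θ + (k + 1)) s ≤ ms θ t / 2 ^ k := by
  induction θ generalizing t s with
  | zero =>
    rw [BulkBalanceRel] at h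
    rcases h with ⟨rfl, rfl⟩ | h
    · refine ⟨rfl, by omega, fun _ => by simp [ht], ?_⟩
      rw [ms_eq_zero (by simp [ht])]; exact Nat.zero_le _
    · obtain ⟨h1, h2, h3, h4⟩ := balance_result hk hb h
      refine ⟨h1, h2, ?_, ?_⟩
      · simpa [ms] using h3
      · simpa [ms] using h4
  | succ θ ih =>
    cases t with
    | leaf =>
      rw [BulkBalanceRel] at h
      subst h
      refine ⟨rfl, by omega, fun _ => by simp [ht], ?_⟩
      rw [ms_eq_zero (by simp [ht])]; exact Nat.zero_le _
    | node l v r =>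
      rw [BulkBalanceRel] at h
      obtain ⟨l', r', hl, hr, rfl⟩ := h
      obtain ⟨a1, a2, a3, a4⟩ := ih hb.2.2.1 hl
      obtain ⟨b1, b2, b3, b4⟩ := ih hb.2.2.2 hr
      refine ⟨by simp [inorder, a1, b1], by simp only [ht]; omega, ?_, ?_⟩
      · intro h
        simp only [ms] at h
        have := a3 (by omega)
        have := b3 (by omega)
        simp only [ht]; omega
      · rw [show θ + 1 + (k + 1) = (θ + (k + 1)) + 1 by ring]
        simp only [ms]
        refine max_le (a4.trans ?_) (b4.trans ?_)
        · exact Nat.div_le_div_right (le_max_left _ _)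
        · exact Nat.div_le_div_right (le_max_right _ _)

/-! ### One step and one phase -/

theorem step {k : ℕ} (hk : 1 ≤ k) (θ : ℕ) {t t₁ t₂ t' : BT} (hb : t.isBST)
    (hc : Chunks 1 t.nodes t'.nodes)
    (h1 : BulkBalanceRel k θ t t₁) (h2 : BulkInsertRel t₁ (t'.nodes \ t.nodes) t₂)
    (h3 : BulkDeleteRel t₂ (t.nodes \ t'.nodes) t') :
    ht t' ≤ ht t + 2 ∧ ms (θ + (k + 1)) t' * 2 ^ k ≤ 3 * ms θ t := by
  obtain ⟨a1, a2, a3, a4⟩ := bulkBalance hk θ hb h1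
  obtain ⟨I, hI, hI', rfl⟩ := h2
  obtain ⟨D, hD, hD', he⟩ := h3
  have hn := nodes_of_inorder a1
  have hmem : ∀ x ∈ I, x ∈ t'.nodes ∧ x ∉ t.nodes := by
    intro x hx
    have : x ∈ I.toFinset := List.mem_toFinset.2 hx
    rw [hI', Finset.mem_sdiff] at this
    exact this
  obtain ⟨b1, b2, b3⟩ := foldl_ins t₁ (bst_of_inorder a1 hb) I hI
    (by rw [hn]; exact fun x hx => (hmem x hx).2)
    (by rw [hn]; exact fun a ha b hb hab => chunks_pair hc (hmem a ha).1 (hmem b hb).1 hab)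
  obtain ⟨c1, c2⟩ := foldl_delete D (I.foldl BT.ins t₁)
  rw [← he] at c1 c2
  refine ⟨by omega, ?_⟩
  by_cases hs : ms θ t < 2 ^ k
  · have := a3 hs
    rw [ms_eq_zero (by omega)]; simp
  · have d1 := c2 (θ + (k + 1))
    have d2 := b3 (θ + (k + 1))
    have d3 : ms (θ + (k + 1)) t₁ * 2 ^ k ≤ ms θ t :=
      (Nat.mul_le_mul_right _ a4).trans (Nat.div_mul_le_self _ _)
    have d4 : ms (θ + (k + 1)) t' * 2 ^ k ≤ (2 * ms (θ + (k + 1)) t₁ + 1) * 2 ^ k :=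
      Nat.mul_le_mul_right _ (d1.trans d2)
    have d5 : (2 * ms (θ + (k + 1)) t₁ + 1) * 2 ^ k =
      2 * (ms (θ + (k + 1)) t₁ * 2 ^ k) + 2 ^ k := by ring
    omega

theorem phase {k q : ℕ} (hk : 1 ≤ k) {T : ℕ → BT} (h : OnePhaseSeq k q T) (y : ℕ) (hy : y ≤ q) :
    0 < (T y).size ∧ ht (T y) ≤ ht (T 0) + 2 * y ∧ (T 0).size ≤ 3 ^ y * (T y).size ∧
      ms (y * (k + 1)) (T y) * (2 ^ k) ^ y ≤ 3 ^ y * (T 0).size := by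
  obtain ⟨hb, hne, hc, hs⟩ := h
  have hpos : ∀ y ≤ q, 0 < (T y).size := by
    intro y hy
    rw [← card_nodes (hb y hy)]
    exact Finset.card_pos.2 (hne y hy)
  refine ⟨hpos y hy, ?_⟩
  induction y with
  | zero => simp [ms]
  | succ y ih =>
    obtain ⟨i1, i2, i3⟩ := ih (by omega)
    obtain ⟨hh, t₁, t₂, h1, h2, h3⟩ := hs y (by omega)
    obtain ⟨c1, c2⟩ := hc y (by omega)
    obtain ⟨s1, s2⟩ := step hk _ (hb y (by omega)) c1 h1 h2 h3
    have hcard := chunks_card c2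
    rw [card_nodes (hb y (by omega)), card_nodes (hb (y + 1) hy)] at hcard
    have hp := hpos (y + 1) hy
    refine ⟨by omega, ?_, ?_⟩
    · calc (T 0).size ≤ 3 ^ y * (T y).size := i2
        _ ≤ 3 ^ y * (3 * (T (y + 1)).size) := Nat.mul_le_mul_left _ (by omega)
        _ = 3 ^ (y + 1) * (T (y + 1)).size := by ring
    · rw [show (y + 1) * (k + 1) = y * (k + 1) + (k + 1) by ring]
      calc ms (y * (k + 1) + (k + 1)) (T (y + 1)) * (2 ^ k) ^ (y + 1)
          = (ms (y * (k + 1) + (k + 1)) (T (y + 1)) * 2 ^ k) * (2 ^ k) ^ y := by ring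
        _ ≤ (3 * ms (y * (k + 1)) (T y)) * (2 ^ k) ^ y := Nat.mul_le_mul_right _ s2
        _ = 3 * (ms (y * (k + 1)) (T y) * (2 ^ k) ^ y) := by ring
        _ ≤ 3 * (3 ^ y * (T 0).size) := Nat.mul_le_mul_left _ i3
        _ = 3 ^ (y + 1) * (T 0).size := by ring

theorem phase_pow {k q : ℕ} (hk : 1 ≤ k) {T : ℕ → BT} (h : OnePhaseSeq k q T) (u : ℕ)
    (hu : u + 1 ≤ q) : 2 ^ (k * u) ≤ 3 ^ (2 * u + 1) * (T (u + 1)).size := by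
  obtain ⟨_, _, _, h4⟩ := phase hk h u (by omega)
  obtain ⟨_, _, h3, _⟩ := phase hk h (u + 1) hu
  have hh := (h.2.2.2 u (by omega)).1
  rw [height_eq (h.1 u (by omega))] at hh
  have hp : 0 < ms (u * (k + 1)) (T u) := ms_pos (by omega)
  calc 2 ^ (k * u) = 1 * (2 ^ k) ^ u := by rw [one_mul, pow_mul]
    _ ≤ ms (u * (k + 1)) (T u) * (2 ^ k) ^ u := Nat.mul_le_mul_right _ hp
    _ ≤ 3 ^ u * (T 0).size := h4
    _ ≤ 3 ^ u * (3 ^ (u + 1) * (T (u + 1)).size) := Nat.mul_le_mul_left _ h3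
    _ = 3 ^ (2 * u + 1) * (T (u + 1)).size := by ring

theorem log3 : Real.logb 2 3 ≤ 8 / 5 := by
  have h : Real.logb 2 ((3 : ℝ) ^ 5) ≤ Real.logb 2 ((2 : ℝ) ^ 8) :=
    Real.logb_le_logb_of_le (by norm_num) (by norm_num) (by norm_num)
  rw [Real.logb_pow, Real.logb_pow, Real.logb_self_eq_one (by norm_num)] at h
  norm_num at h ⊢
  linarith

/-- Binary logarithm of the size. -/
noncomputable def lg (t : BT) : ℝ := Real.logb 2 (t.size : ℝ)

theorem lg_le {a b : BT} {m : ℕ} (ha : 0 < a.size) (hb : 0 < b.size)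
    (h : a.size ≤ 3 ^ m * b.size) : lg a ≤ 8 / 5 * m + lg b := by
  have ha' : (0 : ℝ) < a.size := by exact_mod_cast ha
  have hb' : (0 : ℝ) < b.size := by exact_mod_cast hb
  have h' : (a.size : ℝ) ≤ 3 ^ m * b.size := by exact_mod_cast h
  have := Real.logb_le_logb_of_le (b := 2) (by norm_num) ha' h'
  rw [Real.logb_mul (by positivity) hb'.ne', Real.logb_pow] at this
  have h3 := mul_le_mul_of_nonneg_left log3 (Nat.cast_nonneg (α := ℝ) m)
  unfold lg
  linarith

theorem phase_log {k q : ℕ} (hk : 1 ≤ k) {T : ℕ → BT} (h : OnePhaseSeq k q T) (u : ℕ)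
    (hu : u + 1 ≤ q) : (k : ℝ) * u ≤ 8 / 5 * (2 * u + 1) + lg (T (u + 1)) := by
  have hp := (phase hk h (u + 1) hu).1
  have hb' : (0 : ℝ) < (T (u + 1)).size := by exact_mod_cast hp
  have h' : (2 : ℝ) ^ (k * u) ≤ 3 ^ (2 * u + 1) * (T (u + 1)).size := by
    exact_mod_cast phase_pow hk h u hu
  have := Real.logb_le_logb_of_le (b := 2) (by norm_num) (by positivity) h'
  rw [Real.logb_mul (by positivity) hb'.ne', Real.logb_pow, Real.logb_pow,
    Real.logb_self_eq_one (by norm_num)] at this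
  push_cast at this
  have h3 := mul_le_mul_of_nonneg_left log3 (by positivity : (0 : ℝ) ≤ 2 * u + 1)
  unfold lg
  linarith

theorem lg_nonneg (t : BT) : 0 ≤ lg t := by
  unfold lg
  rcases Nat.eq_zero_or_pos t.size with h | h
  · simp [h]
  · exact Real.logb_nonneg (by norm_num) (by exact_mod_cast h)

/-- `u ≤ 3 L / k + 1`. -/
theorem u_bound {k u L e : ℝ} (hk : 5 ≤ k) (hu : 0 ≤ u) (he : k * e = L)
    (h : k * u ≤ 8 / 5 * (2 * u + 1) + L) : u ≤ 3 * e + 1 := by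
  by_contra hc
  push Not at hc
  have h1 : 0 ≤ (k - 5) * u := mul_nonneg (by linarith) hu
  have h2 : k * (3 * e + 1) < k * u := mul_lt_mul_of_pos_left hc (by linarith)
  nlinarith

/-- The bound at phase boundaries. -/
def Good (k : ℕ) (t : BT) : Prop := (t.height : ℝ) ≤ lg t + 13 * (k + lg t / k)

theorem phase_end {k q : ℕ} (hk : 5 ≤ k) {T : ℕ → BT} (h : OnePhaseSeq k q T) (hq : 1 ≤ q)
    (hh : (T q).height ≤ q * (k + 1)) : Good k (T q) := by
  obtain ⟨u, rfl⟩ : ∃ u, q = u + 1 := ⟨q - 1, by omega⟩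
  have hlog := phase_log (by omega) h u le_rfl
  have hk' : (5 : ℝ) ≤ k := by exact_mod_cast hk
  have hL := lg_nonneg (T (u + 1))
  have hh' : ((T (u + 1)).height : ℝ) ≤ (u + 1) * (k + 1) := by exact_mod_cast hh
  unfold Good
  generalize lg (T (u + 1)) = L at *
  have he : (k : ℝ) * (L / k) = L := by field_simp
  have he0 : 0 ≤ L / k := by positivity
  generalize L / (k : ℝ) = e at *
  have hu : (0 : ℝ) ≤ u := Nat.cast_nonneg u
  have := u_bound hk' hu he hlog
  nlinarith

theorem phase_mid {k q : ℕ} (hk : 5 ≤ k) {T : ℕ → BT} (h : OnePhaseSeq k q T)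
    (h0 : Good k (T 0)) (y : ℕ) (hy : y ≤ q) :
    ((T y).height : ℝ) ≤ lg (T y) + 40 * (k + lg (T y) / k) := by
  have hk' : (5 : ℝ) ≤ k := by exact_mod_cast hk
  unfold Good at h0
  rcases Nat.eq_zero_or_pos y with rfl | hy0
  · have hL := lg_nonneg (T 0)
    have : 0 ≤ lg (T 0) / k := by positivity
    linarith
  obtain ⟨u, rfl⟩ : ∃ u, y = u + 1 := ⟨y - 1, by omega⟩
  obtain ⟨p1, p2, p3, _⟩ := phase (by omega) h (u + 1) hy
  have p0 := (phase (by omega) h 0 (by omega)).1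
  have hlog := phase_log (by omega) h u hy
  have hl0 := lg_le p0 p1 p3
  have hht : (T (u + 1)).height ≤ (T 0).height + 2 * (u + 1) := by
    rw [height_eq (h.1 _ hy), height_eq (h.1 0 (by omega))]
    have : 0 < ht (T 0) := by
      by_contra hc
      have h1 := size_lt (T 0)
      rw [show ht (T 0) = 0 by omega] at h1
      omega
    omega
  have hht' : ((T (u + 1)).height : ℝ) ≤ (T 0).height + 2 * (u + 1) := by exact_mod_cast hht
  have hL := lg_nonneg (T (u + 1))
  push_cast at hl0
  generalize lg (T (u + 1)) = L at *
  generalize lg (T 0) = L0 at *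
  have he : (k : ℝ) * (L / k) = L := by field_simp
  have he0 : 0 ≤ L / k := by positivity
  have hu : (0 : ℝ) ≤ u := Nat.cast_nonneg u
  have h5 : L0 / k ≤ L / k + 8 / 25 * (u + 1) := by
    rw [div_le_iff₀ (by linarith)]
    have : (L / k + 8 / 25 * (u + 1)) * k = L + 8 / 25 * ((u + 1) * k) := by field_simp
    rw [this]
    nlinarith
  generalize L / (k : ℝ) = e at *
  have := u_bound hk' hu he hlog
  linarith

theorem perf_good {k : ℕ} {s : Finset ℝ} {t : BT} (h : IsPerfBalBST s t) : Good k t := by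
  unfold Good
  have h1 := lg_nonneg t
  have h2 : 0 ≤ lg t / k := by positivity
  have h3 : (t.height : ℝ) ≤ lg t := by
    rw [h.2.2]
    unfold lg
    exact_mod_cast Real.natLog_le_logb t.size 2
  have : (0 : ℝ) ≤ k := Nat.cast_nonneg k
  linarith

end BTP

/-- bulk trees are always balanced: there is a constant `C > 0` such
that for every `k ≥ 5`, every `k`-bulk tree sequence `T_1, …, T_h` and every
`y ∈ {1,…,h}`, `h(T_y) ≤ log₂ |T_y| + C(k + log₂ |T_y| / k)`. -/
theorem bulk_tree_sequence_height :
    ∃ C : ℝ, 0 < C ∧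
      ∀ k h : ℕ, 5 ≤ k → ∀ T : ℕ → BT, KBulkSeq k h T →
        ∀ y, 1 ≤ y → y ≤ h →
          ((T y).height : ℝ) ≤
            Real.logb 2 ((T y).size) +
              C * ((k : ℝ) + Real.logb 2 ((T y).size) / k) := by
  refine ⟨40, by norm_num, ?_⟩
  rintro k h hk T ⟨hT, ℓ, hℓ, hs, hs1, hsl, hmono, hph⟩ y hy1 hyh
  change ((T y).height : ℝ) ≤ BTP.lg (T y) + 40 * ((k : ℝ) + BTP.lg (T y) / k)
  have hgood : ∀ j, 1 ≤ j → j < ℓ → BTP.Good k (T (hs j)) := by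
    intro j hj hjl
    rcases Nat.lt_or_ge 1 j with h1 | h1
    · obtain ⟨i, rfl⟩ : ∃ i, j = i + 1 := ⟨j - 1, by omega⟩
      obtain ⟨a1, a2⟩ := hph i (by omega) (by omega)
      have hm := hmono i (by omega) (by omega)
      have he : hs i + (hs (i + 1) - hs i) = hs (i + 1) := by omega
      have := BTP.phase_end hk a1 (by omega) (by
        simp only [he]
        exact a2 (by omega))
      simpa only [he] using this
    · have : j = 1 := by omega
      subst this
      rw [hs1]
      exact BTP.perf_good hT
  have hloc : ∀ m, 1 ≤ m → m ≤ ℓ → y ≤ hs m →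
      y = 1 ∨ ∃ j, 1 ≤ j ∧ j < ℓ ∧ hs j ≤ y ∧ y ≤ hs (j + 1) := by
    intro m hm
    induction m, hm using Nat.le_induction with
    | base =>
      intro _ h
      left; omega
    | succ m hm ih =>
      intro hml hym
      rcases Nat.lt_or_ge y (hs m) with h1 | h1
      · exact ih (by omega) h1.le
      · exact Or.inr ⟨m, hm, by omega, h1, hym⟩
  rcases hloc ℓ hℓ le_rfl (by omega) with rfl | ⟨j, hj1, hj2, h1, h2⟩
  · have hg : BTP.Good k (T 1) := BTP.perf_good hT
    unfold BTP.Good at hg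
    have hL := BTP.lg_nonneg (T 1)
    have : 0 ≤ BTP.lg (T 1) / k := by positivity
    have : (0 : ℝ) ≤ k := Nat.cast_nonneg k
    linarith
  · have := BTP.phase_mid hk (hph j hj1 hj2).1 (hgood j hj1 hj2) (y - hs j) (by omega)
    have he : hs j + (y - hs j) = y := by omega
    simpa only [he] using this
end

section
/- There exist a constant C > 0 and a function A : {0,1}* × {0,1}* → {0,1} such that for every integer t ≥ 1 and every t-tree H on m ≥ 2 vertices, there exists an injective labelling ℓ : V(H) → {0,1}* with |ℓ(v)| ≤ log₂ m + C·t·(log₂(log₂ m + 2) + log₂(t+1) + 1) for every vertex v, and such that for all distinct vertices v, w of H, A(ℓ(v), ℓ(w)) = 1 if and only if vw ∈ E(H). The constant C and the function A do not depend on t, m, or H. -/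
attribute [local instance] Classical.propDecidable

/-- `H` is a `t`-tree: there is an ordering of the vertices (an equivalence with
`Fin (card V)`) such that, for every vertex `v`, the neighbours of `v` coming earlier
in the ordering form a clique of size at most `t` in `H`. -/
def IsTTree (t : ℕ) {V : Type*} [Fintype V] (H : SimpleGraph V) : Prop :=
  ∃ e : V ≃ Fin (Fintype.card V),
    ∀ v : V, H.IsClique {w | H.Adj v w ∧ e w < e v} ∧
      {w | H.Adj v w ∧ e w < e v}.ncard ≤ t

namespace TTreeLab

/-- Self-delimiting code of a bit list, followed by `r`. -/
def encB : List Bool → List Bool → List Bool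
  | [], r => false :: r
  | b :: bs, r => true :: b :: encB bs r

theorem encB_inj : ∀ (a b r s : List Bool), encB a r = encB b s → a = b ∧ r = s
  | [], [], r, s, h => by simpa [encB] using h
  | [], _ :: _, r, s, h => by simp [encB] at h
  | _ :: _, [], r, s, h => by simp [encB] at h
  | x :: a, y :: b, r, s, h => by
      simp only [encB, List.cons.injEq, true_and] at h
      obtain ⟨h1, h2⟩ := h
      obtain ⟨h3, h4⟩ := encB_inj a b r s h2
      exact ⟨by rw [h1, h3], h4⟩

theorem encB_length : ∀ (a r : List Bool), (encB a r).length = 2 * a.length + 1 + r.length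
  | [], r => by simp [encB]; omega
  | _ :: a, r => by simp [encB, encB_length a r]; omega

/-- Code of a number together with a list of numbers. -/
def E (p : ℕ) : List ℕ → List Bool
  | [] => false :: p.bits
  | x :: l => true :: encB x.bits (E p l)

theorem bits_inj {a b : ℕ} (h : a.bits = b.bits) : a = b := by
  apply Nat.eq_of_testBit_eq
  intro i
  rw [Nat.testBit_eq_inth, Nat.testBit_eq_inth, h]

theorem E_inj : ∀ (l k : List ℕ) (p q : ℕ), E p l = E q k → p = q ∧ l = k
  | [], [], p, q, h => by
      simp only [E, List.cons.injEq, true_and] at h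
      exact ⟨bits_inj h, rfl⟩
  | [], _ :: _, p, q, h => by simp [E] at h
  | _ :: _, [], p, q, h => by simp [E] at h
  | x :: l, y :: k, p, q, h => by
      simp only [E, List.cons.injEq, true_and] at h
      obtain ⟨h1, h2⟩ := encB_inj _ _ _ _ h
      obtain ⟨h3, h4⟩ := E_inj l k p q h2
      exact ⟨h3, by rw [bits_inj h1, h4]⟩

theorem E_length (p s : ℕ) : ∀ (l : List ℕ), (∀ x ∈ l, x.size ≤ s) →
    (E p l).length ≤ p.size + 1 + l.length * (2 * s + 2)
  | [], _ => by simp [E, Nat.size_eq_bits_len]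
  | x :: l, h => by
      have h1 := E_length p s l (fun y hy => h y (by simp [hy]))
      have h2 := h x (by simp)
      rw [← Nat.size_eq_bits_len] at h2
      simp only [E, List.length_cons, encB_length]
      have : (l.length + 1) * (2 * s + 2) = l.length * (2 * s + 2) + (2 * s + 2) := by ring
      omega

/-- The adjacency predicate on label data. -/
def P (p x : ℕ) (l : List ℕ) (q : ℕ) (y : ℕ) : Prop :=
  y ∈ l ∧ p / 2 ^ (Nat.unpair y).1 = q / 2 ^ (Nat.unpair y).1

/-- The universal decoder. -/
noncomputable def dec (a b : List Bool) : Bool :=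
  decide (∃ p x l q y k, a = E p (x :: l) ∧ b = E q (y :: k) ∧ (P p x l q y ∨ P q y k p x))

theorem dec_iff (p x : ℕ) (l : List ℕ) (q y : ℕ) (k : List ℕ) :
    dec (E p (x :: l)) (E q (y :: k)) = true ↔ (P p x l q y ∨ P q y k p x) := by
  unfold dec
  rw [decide_eq_true_iff]
  constructor
  · rintro ⟨p', x', l', q', y', k', h1, h2, h3⟩
    obtain ⟨rfl, h4⟩ := E_inj _ _ _ _ h1
    obtain ⟨rfl, h5⟩ := E_inj _ _ _ _ h2
    obtain ⟨rfl, rfl⟩ := List.cons.inj h4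
    obtain ⟨rfl, rfl⟩ := List.cons.inj h5
    exact h3
  · intro h
    exact ⟨p, x, l, q, y, k, rfl, rfl, h⟩

/-- Level of the smallest dyadic interval containing `a` and `b`. -/
theorem exists_level (a b L : ℕ) (ha : a < 2 ^ L) (hb : b < 2 ^ L) :
    ∃ j ≤ L, a / 2 ^ j = b / 2 ^ j ∧ ∀ i < j, a / 2 ^ i ≠ b / 2 ^ i := by
  have hL : a / 2 ^ L = b / 2 ^ L := by rw [Nat.div_eq_of_lt ha, Nat.div_eq_of_lt hb]
  have hex : ∃ j, a / 2 ^ j = b / 2 ^ j := ⟨L, hL⟩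
  exact ⟨Nat.find hex, Nat.find_min' hex hL, Nat.find_spec hex, fun i hi => Nat.find_min hex hi⟩

theorem level_inter (a b a' b' j : ℕ) (hab : a ≤ b) (hab' : a' ≤ b')
    (h : a / 2 ^ j = b / 2 ^ j) (h' : a' / 2 ^ j = b' / 2 ^ j)
    (hm : ∀ i < j, a / 2 ^ i ≠ b / 2 ^ i) (hm' : ∀ i < j, a' / 2 ^ i ≠ b' / 2 ^ i)
    (heq : a / 2 ^ j = a' / 2 ^ j) : a ≤ b' := by
  cases j with
  | zero => simp at h h' heq; omega
  | succ i =>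
    have h1 := hm i (by omega)
    have h2 := hm' i (by omega)
    have h3 : a / 2 ^ i ≤ b / 2 ^ i := Nat.div_le_div_right hab
    have h4 : a' / 2 ^ i ≤ b' / 2 ^ i := Nat.div_le_div_right hab'
    simp only [pow_succ, ← Nat.div_div_eq_div_mul] at h h' heq
    by_contra hlt
    have h5 : b' / 2 ^ i ≤ a / 2 ^ i := Nat.div_le_div_right (by omega)
    omega

section graph

variable {V : Type} [Fintype V] (H : SimpleGraph V)

/-- `H[S]` has an interval supergraph, with positions below `|S|`, properly coloured
with `K` colours. -/
def Good (S : Finset V) (K : ℕ) : Prop :=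
  ∃ lo hi c : V → ℕ, (∀ v ∈ S, lo v ≤ hi v ∧ hi v < S.card ∧ c v < K) ∧
    ∀ v ∈ S, ∀ w ∈ S, v ≠ w →
      (lo v ≤ hi w → lo w ≤ hi v → c v ≠ c w) ∧ (H.Adj v w → lo v ≤ hi w)

theorem good_empty (K : ℕ) : Good H ∅ K :=
  ⟨fun _ => 0, fun _ => 0, fun _ => 0, by simp, by simp⟩

theorem good_union {A B : Finset V} {K : ℕ} (hA : Good H A K) (hB : Good H B K)
    (hd : Disjoint A B) (hn : ∀ a ∈ A, ∀ b ∈ B, ¬ H.Adj a b) : Good H (A ∪ B) K := by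
  obtain ⟨lo, hi, c, h1, h2⟩ := hA
  obtain ⟨lo', hi', c', h1', h2'⟩ := hB
  have hdj : ∀ x ∈ B, x ∉ A := fun x hx hx' => Finset.disjoint_left.mp hd hx' hx
  refine ⟨fun v => if v ∈ A then lo v else A.card + lo' v,
    fun v => if v ∈ A then hi v else A.card + hi' v,
    fun v => if v ∈ A then c v else c' v, ?_, ?_⟩
  · intro v hv
    rw [Finset.card_union_of_disjoint hd]
    by_cases hvA : v ∈ A
    · have := h1 v hvA
      simp only [hvA, if_true]
      omega
    · have := h1' v (by simpa [hvA] using hv)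
      simp only [hvA, if_false]
      omega
  · intro v hv w hw hvw
    by_cases hvA : v ∈ A <;> by_cases hwA : w ∈ A
    · simpa only [hvA, hwA, if_true] using h2 v hvA w hwA hvw
    · have hwB : w ∈ B := by simpa [hwA] using hw
      simp only [hvA, hwA, if_true, if_false]
      have := h1 v hvA
      exact ⟨fun _ h => by omega, fun h => absurd h (hn v hvA w hwB)⟩
    · have hvB : v ∈ B := by simpa [hvA] using hv
      simp only [hvA, hwA, if_true, if_false]
      have := h1 w hwA
      exact ⟨fun h _ => by omega, fun h => absurd h.symm (hn w hwA v hvB)⟩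
    · have hvB : v ∈ B := by simpa [hvA] using hv
      have hwB : w ∈ B := by simpa [hwA] using hw
      simpa only [hvA, hwA, if_false, add_le_add_iff_left] using h2' v hvB w hwB hvw

theorem good_sep {S X : Finset V} {K s : ℕ} (hS : Good H (S \ X) K) (hX : X ⊆ S)
    (hs : X.card ≤ s) : Good H S (K + s) := by
  obtain ⟨lo, hi, c, h1, h2⟩ := hS
  have hle : (S \ X).card ≤ S.card := Finset.card_le_card Finset.sdiff_subset
  let f : V → ℕ := fun v => if h : v ∈ X then (X.equivFin ⟨v, h⟩ : ℕ) else 0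
  have hf : ∀ v ∈ X, f v < s := by
    intro v hv
    simp only [f, hv, dif_pos]
    exact lt_of_lt_of_le (Fin.is_lt _) hs
  have hfi : ∀ v ∈ X, ∀ w ∈ X, f v = f w → v = w := by
    intro v hv w hw h
    simp only [f, hv, hw, dif_pos] at h
    have := X.equivFin.injective (Fin.ext h)
    simpa using this
  refine ⟨fun v => if v ∈ X then 0 else lo v,
    fun v => if v ∈ X then S.card - 1 else hi v,
    fun v => if v ∈ X then K + f v else c v, ?_, ?_⟩
  · intro v hv
    have hpos : 0 < S.card := Finset.card_pos.mpr ⟨v, hv⟩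
    by_cases hvX : v ∈ X
    · have := hf v hvX
      simp only [hvX, if_true]
      omega
    · have := h1 v (by simp [hv, hvX])
      simp only [hvX, if_false]
      omega
  · intro v hv w hw hvw
    by_cases hvX : v ∈ X <;> by_cases hwX : w ∈ X
    · simp only [hvX, hwX, if_true]
      refine ⟨fun _ _ h => hvw (hfi v hvX w hwX (by omega)), fun _ => by omega⟩
    · have := h1 w (by simp [hw, hwX])
      simp only [hvX, hwX, if_true, if_false]
      exact ⟨fun _ _ => by omega, fun _ => by omega⟩
    · have := h1 v (by simp [hv, hvX])
      simp only [hvX, hwX, if_true, if_false]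
      exact ⟨fun _ _ => by omega, fun _ => by omega⟩
    · simpa only [hvX, hwX, if_false] using
        h2 v (by simp [hv, hvX]) w (by simp [hw, hwX]) hvw

theorem good_mono {S : Finset V} {K K' : ℕ} (h : Good H S K) (hK : K ≤ K') : Good H S K' := by
  obtain ⟨lo, hi, c, h1, h2⟩ := h
  exact ⟨lo, hi, c, fun v hv => by have := h1 v hv; omega, h2⟩

variable (e : V → ℕ)

/-- `a` is the parent of `b`: the latest earlier neighbour of `b`. -/
def R (a b : V) : Prop :=
  (H.Adj b a ∧ e a < e b) ∧ ∀ c, H.Adj b c ∧ e c < e b → e c ≤ e a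

/-- `u` is a descendant of `v`. -/
def D (v u : V) : Prop := Relation.ReflTransGen (R H e) v u

theorem D_lt {v u : V} (h : D H e v u) : u = v ∨ e v < e u := by
  induction h with
  | refl => exact Or.inl rfl
  | tail _ h2 ih =>
    right
    have := h2.1.2
    rcases ih with rfl | ih
    · exact this
    · omega

theorem exists_parent {u w : V} (h : H.Adj u w ∧ e w < e u) : ∃ p, R H e p u := by
  obtain ⟨p, hp, hmax⟩ := Finset.exists_max_image
    (Finset.univ.filter (fun w => H.Adj u w ∧ e w < e u)) e ⟨w, by simpa using h⟩
  exact ⟨p, by simpa using hp, fun c hc => hmax c (by simpa using hc)⟩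

variable (he : Function.Injective e)
  (hcl : ∀ v a b, H.Adj v a → e a < e v → H.Adj v b → e b < e v → a ≠ b → H.Adj a b)

include he hcl in
theorem adj_D (n : ℕ) : ∀ u w, e u = n → H.Adj u w → e w < e u → D H e w u := by
  induction n using Nat.strong_induction_on with
  | _ n ih =>
    intro u w hn h hlt
    obtain ⟨p, hp⟩ := exists_parent H e ⟨h, hlt⟩
    by_cases hwp : w = p
    · subst hwp; exact Relation.ReflTransGen.single hp
    · have hle := hp.2 w ⟨h, hlt⟩
      have hne : e w ≠ e p := fun h => hwp (he h)
      have hadj := hcl u p w hp.1.1 hp.1.2 h hlt (Ne.symm hwp)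
      exact Relation.ReflTransGen.tail
        (ih (e p) (by have := hp.1.2; omega) p w rfl hadj (by omega)) hp

include he hcl in
theorem D_nbr {v u w : V} (hu : D H e v u) (hw : ¬ D H e v w) (h : H.Adj u w) :
    H.Adj v w ∧ e w < e v := by
  have hlt : e w < e u := by
    by_contra hge
    have hne : e u ≠ e w := fun h' => h.ne (he h')
    exact hw (Relation.ReflTransGen.trans hu
      (adj_D H e he hcl (e w) w u rfl h.symm (by omega)))
  induction hu with
  | refl => exact ⟨h, hlt⟩
  | @tail p u hvp hpu ih =>
    have hwp : w ≠ p := by rintro rfl; exact hw hvp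
    have hle := hpu.2 w ⟨h, hlt⟩
    have hne : e w ≠ e p := fun h => hwp (he h)
    exact ih (hcl u p w hpu.1.1 hpu.1.2 h hlt hwp.symm) (by omega)

include he hcl in
theorem good_forest (M K : ℕ) (IH : ∀ S : Finset V, S.card < M → Good H S K) (n : ℕ) :
    ∀ S : Finset V, S.card = n → (∀ v ∈ S, (S.filter (D H e v)).card < M) → Good H S K := by
  induction n using Nat.strong_induction_on with
  | _ n ih =>
    intro S hn hS
    rcases S.eq_empty_or_nonempty with rfl | hne
    · exact good_empty H K
    obtain ⟨v, hv, hmin⟩ := Finset.exists_min_image S e hne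
    have hsplit : S.filter (D H e v) ∪ S.filter (fun u => ¬ D H e v u) = S :=
      Finset.filter_union_filter_not_eq _ _
    rw [← hsplit]
    apply good_union
    · exact IH _ (hS v hv)
    · refine ih _ ?_ _ rfl ?_
      · rw [← hn]
        apply Finset.card_lt_card
        rw [Finset.filter_ssubset]
        exact ⟨v, hv, fun h => h Relation.ReflTransGen.refl⟩
      · intro w hw
        refine lt_of_le_of_lt (Finset.card_le_card ?_) (hS w (Finset.mem_filter.mp hw).1)
        exact Finset.filter_subset_filter _ (Finset.filter_subset _ _)
    · exact Finset.disjoint_filter_filter_not _ _ _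
    · intro a ha b hb hab
      rw [Finset.mem_filter] at ha hb
      have := D_nbr H e he hcl ha.2 hb.2 hab
      have := hmin b hb.1
      omega

include he hcl in
theorem good_all (t : ℕ)
    (ht : ∀ v, (Finset.univ.filter (fun w => H.Adj v w ∧ e w < e v)).card ≤ t) (k : ℕ) :
    ∀ S : Finset V, S.card < 2 ^ k → Good H S ((t + 1) * k) := by
  induction k with
  | zero =>
    intro S hS
    have : S = ∅ := by simpa using hS
    subst this
    exact good_empty H _
  | succ k IH =>
    intro S hS
    by_cases hbig : ∃ v, 2 ^ k ≤ (S.filter (D H e v)).card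
    · obtain ⟨v, hv, hmax⟩ := Finset.exists_max_image
        (Finset.univ.filter (fun v => 2 ^ k ≤ (S.filter (D H e v)).card)) e
        (by obtain ⟨v, hv⟩ := hbig; exact ⟨v, by simpa using hv⟩)
      have hv : 2 ^ k ≤ (S.filter (D H e v)).card := by simpa using hv
      let X := S ∩ insert v (Finset.univ.filter (fun w => H.Adj v w ∧ e w < e v))
      have hXm : ∀ u, u ∈ X ↔ u ∈ S ∧ (u = v ∨ (H.Adj v u ∧ e u < e v)) := by
        intro u; simp [X]
      have hXc : X.card ≤ t + 1 :=
        (Finset.card_le_card Finset.inter_subset_right).trans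
          ((Finset.card_insert_le _ _).trans (by have := ht v; omega))
      rw [mul_add, mul_one]
      refine good_sep H (X := X) ?_ Finset.inter_subset_left hXc
      have hsplit : (S \ X).filter (D H e v) ∪ (S \ X).filter (fun u => ¬ D H e v u) = S \ X :=
        Finset.filter_union_filter_not_eq _ _
      rw [← hsplit]
      apply good_union
      · refine good_forest H e he hcl (2 ^ k) _ IH _ _ rfl ?_
        intro u hu
        rw [Finset.mem_filter, Finset.mem_sdiff, hXm] at hu
        have hsub : (((S \ X).filter (D H e v)).filter (D H e u)).card
            ≤ (S.filter (D H e u)).card :=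
          Finset.card_le_card (Finset.filter_subset_filter _
            ((Finset.filter_subset _ _).trans Finset.sdiff_subset))
        refine lt_of_le_of_lt hsub ?_
        by_contra hge
        have h1 := hmax u (by simpa using hge)
        rcases D_lt H e hu.2 with rfl | h2
        · exact hu.1.2 ⟨hu.1.1, Or.inl rfl⟩
        · omega
      · apply IH
        have h1 : ((S \ X).filter (fun u => ¬ D H e v u)).card
            ≤ (S.filter (fun u => ¬ D H e v u)).card :=
          Finset.card_le_card (Finset.filter_subset_filter _ Finset.sdiff_subset)
        have h2 := Finset.card_filter_add_card_filter_not (s := S) (D H e v)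
        rw [pow_succ] at hS
        omega
      · exact Finset.disjoint_filter_filter_not _ _ _
      · intro a ha b hb hab
        rw [Finset.mem_filter, Finset.mem_sdiff, hXm] at ha hb
        exact hb.1.2 ⟨hb.1.1, Or.inr (D_nbr H e he hcl ha.2 hb.2 hab)⟩
    · push Not at hbig
      exact good_mono H (good_forest H e he hcl (2 ^ k) _ IH _ S rfl (fun v _ => hbig v))
        (by gcongr; omega)

end graph

theorem size_bound (x t L : ℕ) (m : ℝ) (hm : 0 ≤ Real.logb 2 m) (hL : (L : ℝ) ≤ Real.logb 2 m + 1)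
    (hx : x < ((t + 1) * L + 1) ^ 2) :
    (x.size : ℝ) ≤ 2 * (Real.logb 2 (Real.logb 2 m + 2) + Real.logb 2 ((t : ℝ) + 1) + 1) := by
  have hQ1 : 0 ≤ Real.logb 2 (Real.logb 2 m + 2) :=
    Real.logb_nonneg (by norm_num) (by linarith)
  have hQ2 : 0 ≤ Real.logb 2 ((t : ℝ) + 1) :=
    Real.logb_nonneg (by norm_num) (by have : (0:ℝ) ≤ t := by positivity
                                       linarith)
  rcases Nat.eq_zero_or_pos x.size with h0 | hpos
  · rw [h0]; push_cast; linarith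
  · have h1 : 2 ^ (x.size - 1) ≤ x := Nat.lt_size.mp (by omega)
    have h2 : (2:ℝ) ^ (x.size - 1) ≤ (((t:ℝ) + 1) * (Real.logb 2 m + 2)) ^ 2 := by
      have h3 : ((2 ^ (x.size - 1) : ℕ) : ℝ) ≤ ((((t + 1) * L + 1) ^ 2 : ℕ) : ℝ) := by
        exact_mod_cast h1.trans hx.le
      push_cast at h3
      refine h3.trans ?_
      have ht : (0:ℝ) ≤ t := by positivity
      gcongr
      nlinarith
    have h4 := Real.logb_le_logb_of_le (b := 2) (by norm_num) (by positivity) h2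
    rw [Real.logb_pow, Real.logb_pow, Real.logb_mul (by positivity) (by linarith),
      Real.logb_self_eq_one (by norm_num)] at h4
    rw [Nat.cast_sub hpos] at h4
    push_cast at h4
    linarith

end TTreeLab

/-- adjacency labelling of `t`-trees: there are a constant `C > 0`
and a universal adjacency decoder `A` such that every `t`-tree on `m ≥ 2` vertices has
an injective labelling by bit strings of length at most
`log₂ m + C·t·(log₂(log₂ m + 2) + log₂(t+1) + 1)` from which `A` decides adjacency. -/
theorem ttree_adjacency_labelling :
    ∃ C : ℝ, 0 < C ∧ ∃ A : List Bool → List Bool → Bool,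
      ∀ t : ℕ, 1 ≤ t → ∀ (V : Type) (_ : Fintype V), 2 ≤ Fintype.card V →
        ∀ H : SimpleGraph V, IsTTree t H →
          ∃ ℓ : V → List Bool, Function.Injective ℓ ∧
            (∀ v, ((ℓ v).length : ℝ) ≤
              Real.logb 2 (Fintype.card V) +
                C * t * (Real.logb 2 (Real.logb 2 (Fintype.card V) + 2) +
                  Real.logb 2 ((t : ℝ) + 1) + 1)) ∧
            (∀ v w, v ≠ w → (A (ℓ v) (ℓ w) = true ↔ H.Adj v w)) := by
  refine ⟨14, by norm_num, TTreeLab.dec, ?_⟩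
  intro t ht V _ hm H hH
  obtain ⟨e', he'⟩ := hH
  let e : V → ℕ := fun v => (e' v : ℕ)
  have he : Function.Injective e := fun a b h => e'.injective (Fin.ext h)
  have hcl : ∀ v a b, H.Adj v a → e a < e v → H.Adj v b → e b < e v → a ≠ b → H.Adj a b := by
    intro v a b h1 h2 h3 h4 hab
    exact (he' v).1 ⟨h1, h2⟩ ⟨h3, h4⟩ hab
  let N : V → Finset V := fun v => Finset.univ.filter (fun w => H.Adj v w ∧ e w < e v)
  have hN : ∀ v w, w ∈ N v ↔ H.Adj v w ∧ e w < e v := by intro v w; simp [N]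
  have hNc : ∀ v, (N v).card ≤ t := by
    intro v
    have h := (he' v).2
    rw [← Set.ncard_coe_finset]
    convert h using 2
    ext w
    simp [N, e]
  set m := Fintype.card V with hmdef
  let L := Nat.log 2 m + 1
  have hmL : m < 2 ^ L := Nat.lt_pow_succ_log_self (by norm_num) m
  obtain ⟨lo, hi, c, h1, h2⟩ :=
    TTreeLab.good_all H e he hcl t hNc L Finset.univ (by simpa using hmL)
  have h1 : ∀ v, lo v ≤ hi v ∧ hi v < m ∧ c v < (t + 1) * L := fun v => by
    simpa using h1 v (Finset.mem_univ v)
  have h2 : ∀ v w, v ≠ w → (lo v ≤ hi w → lo w ≤ hi v → c v ≠ c w) ∧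
      (H.Adj v w → lo v ≤ hi w) := fun v w =>
    h2 v (Finset.mem_univ v) w (Finset.mem_univ w)
  have hj : ∀ v, ∃ j ≤ L, lo v / 2 ^ j = hi v / 2 ^ j ∧ ∀ i < j, lo v / 2 ^ i ≠ hi v / 2 ^ i := by
    intro v
    have := h1 v
    exact TTreeLab.exists_level _ _ L (by omega) (by omega)
  choose j hjL hjeq hjmin using hj
  -- a point common to the intervals of `v` and its earlier neighbours
  have hp : ∀ v, ∃ p, ∀ w ∈ insert v (N v), lo w ≤ p ∧ p ≤ hi w := by
    intro v
    obtain ⟨u, hu, hmax⟩ := Finset.exists_max_image (insert v (N v)) lo ⟨v, by simp⟩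
    refine ⟨lo u, fun w hw => ⟨hmax w hw, ?_⟩⟩
    by_cases huw : u = w
    · subst huw; exact (h1 u).1
    · refine (h2 u w huw).2 ?_
      rw [Finset.mem_insert, hN] at hu hw
      rcases hu with rfl | hu <;> rcases hw with rfl | hw
      · exact absurd rfl huw
      · exact hw.1
      · exact hu.1.symm
      · exact hcl v u w hu.1 hu.2 hw.1 hw.2 huw
  choose p hp using hp
  have hpj : ∀ v, ∀ w ∈ insert v (N v), p v / 2 ^ j w = lo w / 2 ^ j w := by
    intro v w hw
    have h := hp v w hw
    have h3 : lo w / 2 ^ j w ≤ p v / 2 ^ j w := Nat.div_le_div_right h.1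
    have h4 : p v / 2 ^ j w ≤ hi w / 2 ^ j w := Nat.div_le_div_right h.2
    have := hjeq w
    omega
  have hpv : ∀ v, p v / 2 ^ j v = lo v / 2 ^ j v := fun v => hpj v v (by simp)
  have huniq : ∀ v w, j v = j w → c v = c w → lo v / 2 ^ j v = lo w / 2 ^ j w → v = w := by
    intro v w hjj hcc hll
    by_contra hvw
    have a1 := hjeq v
    have a2 := hjeq w
    have a3 := hjmin v
    have a4 := hjmin w
    rw [← hjj] at a2 a4 hll
    refine (h2 v w hvw).1 ?_ ?_ hcc
    · exact TTreeLab.level_inter _ _ _ _ _ (h1 v).1 (h1 w).1 a1 a2 a3 a4 hll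
    · exact TTreeLab.level_inter _ _ _ _ _ (h1 w).1 (h1 v).1 a2 a1 a4 a3 hll.symm
  let x : V → ℕ := fun v => Nat.pair (j v) (c v)
  let l : V → List ℕ := fun v => (N v).toList.map x
  have hx : ∀ v w, x v = x w → j v = j w ∧ c v = c w := by
    intro v w h
    exact Nat.pair_eq_pair.mp h
  have hxb : ∀ v, x v < ((t + 1) * L + 1) ^ 2 := by
    intro v
    refine lt_of_lt_of_le (Nat.pair_lt_max_add_one_sq _ _) ?_
    have b1 := hjL v
    have b2 := (h1 v).2.2
    have b3 : L ≤ (t + 1) * L := Nat.le_mul_of_pos_left _ (by omega)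
    gcongr
    exact max_le (by omega) (by omega)
  have hP : ∀ v w, TTreeLab.P (p v) (x v) (l v) (p w) (x w) ↔ w ∈ N v := by
    intro v w
    have hun : (Nat.unpair (x w)).1 = j w := by simp [x]
    unfold TTreeLab.P
    rw [hun]
    constructor
    · rintro ⟨hmem, hdiv⟩
      simp only [l, List.mem_map, Finset.mem_toList] at hmem
      obtain ⟨u, hu, hxu⟩ := hmem
      obtain ⟨hju, hcu⟩ := hx u w hxu
      have hpu := hpj v u (by simp [hu])
      have : u = w := by
        apply huniq u w hju hcu
        rw [← hpu, ← hpv w, hju, hdiv]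
      rwa [← this]
    · intro hw
      refine ⟨?_, ?_⟩
      · simp only [l, List.mem_map, Finset.mem_toList]
        exact ⟨w, hw, rfl⟩
      · rw [hpj v w (by simp [hw]), hpv w]
  refine ⟨fun v => TTreeLab.E (p v) (x v :: l v), ?_, ?_, ?_⟩
  · intro v w h
    obtain ⟨hpp, hll⟩ := TTreeLab.E_inj _ _ _ _ h
    simp only [List.cons.injEq] at hll
    obtain ⟨hjj, hcc⟩ := hx v w hll.1
    apply huniq v w hjj hcc
    rw [← hpv v, ← hpv w, hpp, hjj]
  · intro v
    have hm1 : (1:ℝ) ≤ (m:ℝ) := by exact_mod_cast (by omega : 1 ≤ m)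
    have hlog : 0 ≤ Real.logb 2 (m:ℝ) := Real.logb_nonneg (by norm_num) hm1
    have hL : (L : ℝ) ≤ Real.logb 2 (m:ℝ) + 1 := by
      have := Real.natLog_le_logb m 2
      simp only [L]
      push_cast at this ⊢
      linarith
    let s := Nat.size (((t + 1) * L + 1) ^ 2 - 1)
    have hs : ∀ y ∈ x v :: l v, y.size ≤ s := by
      intro y hy
      have : ∃ u, y = x u := by
        simp only [l, List.mem_cons, List.mem_map] at hy
        rcases hy with h | ⟨u, _, h⟩
        · exact ⟨v, h⟩
        · exact ⟨u, h.symm⟩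
      obtain ⟨u, rfl⟩ := this
      exact Nat.size_le_size (by have := hxb u; omega)
    have hsb := TTreeLab.size_bound (((t + 1) * L + 1) ^ 2 - 1) t L m hlog hL
      (by have : 0 < ((t + 1) * L + 1) ^ 2 := by positivity
          omega)
    have hlen := TTreeLab.E_length (p v) s (x v :: l v) hs
    have hll : (x v :: l v).length ≤ t + 1 := by
      have := hNc v
      simp [l]; omega
    have hpL : (p v).size ≤ L := by
      rw [Nat.size_le]
      have b1 := (hp v v (by simp)).2
      have b2 := (h1 v).2.1
      omega
    have hlen2 : (TTreeLab.E (p v) (x v :: l v)).length ≤ L + 1 + (t + 1) * (2 * s + 2) :=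
      hlen.trans (by gcongr)
    have hlen3 : ((TTreeLab.E (p v) (x v :: l v)).length : ℝ) ≤
        L + 1 + ((t:ℝ) + 1) * (2 * s + 2) := by exact_mod_cast hlen2
    have hQ1 : 0 ≤ Real.logb 2 (Real.logb 2 (m:ℝ) + 2) :=
      Real.logb_nonneg (by norm_num) (by linarith)
    have ht1 : (1:ℝ) ≤ t := by exact_mod_cast ht
    have hQ2 : 0 ≤ Real.logb 2 ((t : ℝ) + 1) := Real.logb_nonneg (by norm_num) (by linarith)
    set Q := Real.logb 2 (Real.logb 2 (m:ℝ) + 2) + Real.logb 2 ((t : ℝ) + 1) + 1 with hQ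
    have hQge : 1 ≤ Q := by linarith
    have hsb : (s : ℝ) ≤ 2 * Q := hsb
    have c1 : ((t:ℝ) + 1) * (2 * s + 2) ≤ (2 * t) * (6 * Q) := by
      apply mul_le_mul <;> first | positivity | linarith
    have c2 : 1 ≤ t * Q := one_le_mul_of_one_le_of_one_le ht1 hQge
    calc _ ≤ _ := hlen3
      _ ≤ _ := by nlinarith
  · intro v w hvw
    rw [TTreeLab.dec_iff, hP, hP, hN, hN]
    constructor
    · rintro (h | h)
      · exact h.1
      · exact h.1.symm
    · intro h
      have : e v ≠ e w := fun h' => hvw (he h')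
      rcases lt_or_gt_of_ne this with h' | h'
      · exact Or.inr ⟨h.symm, h'⟩
      · exact Or.inl ⟨h, h'⟩
end
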